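/- Suppose (x*, μ*, λ*) ∈ ℝⁿ × ℝᵐ × E is a KKT triple of problem (P1) such that (SOSC-NSCP) holds: ⟨∇²_x L(x*,μ*,λ*)v, v⟩ + 2⟨w∘w, λ*⟩ > 0 for every nonzero (v, w) with Dg(x*)v − 2√(g(x*))∘w = 0 and Dh(x*)v = 0; and such that x* is nondegenerate: for all v ∈ ℝᵐ, w ∈ E, w ∈ (lin T_K(g(x*)))^⊥ and Dg(x*)*w + Dh(x*)*v = 0 imply w = 0 and v = 0. Then there exist positive scalars δ, ε, M, ρ̄ such that, with D := {(μ, λ, ρ) : ‖μ − μ*‖ + ‖λ − λ*‖ < δρ and ρ ≥ ρ̄}: (1) for every (μ, λ, ρ) ∈ D the problem of minimizing L_ρ^Sym(·, μ, λ) over the closed ball of radius ε centered at x* has a unique solution x(μ, λ, ρ); the map (μ, λ, ρ) ↦ x(μ, λ, ρ) is continuously differentiable on the interior of D and satisfies ‖x(μ, λ, ρ) − x*‖ ≤ (M/ρ)‖(μ, λ) − (μ*, λ*)‖; (2) for every (μ, λ, ρ) ∈ D, setting μ̄ = μ − ρ h(x(μ, λ, ρ)) and λ̄ = P_K(λ −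 ρ g(x(μ, λ, ρ))), one has ‖(μ̄, λ̄) − (μ*, λ*)‖ ≤ (M/ρ)‖(μ, λ) − (μ*, λ*)‖. -/

import Mathlib

open scoped RealInnerProductSpace

noncomputable section

/-- A Euclidean Jordan algebra structure on a finite-dimensional real inner
product space `E`: a commutative bilinear product `jmul` with unit, satisfying
the Jordan identity and compatibility with the inner product, together with the
spectral theorem (every element has a spectral decomposition along a Jordan
frame of size `rank`) and the normalization `⟪c, c⟫ = 1` for primitive
idempotents, which encodes that the inner product is the trace form. -/
structure EJA (E : Type*) [NormedAddCommGroup E] [InnerProductSpace ℝ E]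
    [FiniteDimensional ℝ E] where
  jmul : E →ₗ[ℝ] E →ₗ[ℝ] E
  comm : ∀ y z : E, jmul y z = jmul z y
  unit : E
  unit_jmul : ∀ y : E, jmul unit y = y
  jordan : ∀ y z : E, jmul y (jmul (jmul y y) z) = jmul (jmul y y) (jmul y z)
  assoc_inner : ∀ y z w : E, ⟪jmul y z, w⟫ = ⟪y, jmul z w⟫
  rank : ℕ
  spectral : ∀ y : E, ∃ (c : Fin rank → E) (σ : Fin rank → ℝ),
    (∀ i, jmul (c i) (c i) = c i) ∧
    (∀ i, c i ≠ 0) ∧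
    (∀ i, ∀ a b : E, jmul a a = a → jmul b b = b → a ≠ 0 → b ≠ 0 →
      jmul a b = 0 → c i ≠ a + b) ∧
    (∀ i j, i ≠ j → jmul (c i) (c j) = 0) ∧
    (∑ i, c i) = unit ∧
    y = ∑ i, σ i • c i
  inner_primitive : ∀ c : E, jmul c c = c → c ≠ 0 →
    (∀ a b : E, jmul a a = a → jmul b b = b → a ≠ 0 → b ≠ 0 →
      jmul a b = 0 → c ≠ a + b) →
    ⟪c, c⟫ = 1

namespace EJA

variable {E : Type*} [NormedAddCommGroup E] [InnerProductSpace ℝ E]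
  [FiniteDimensional ℝ E]

/-- `c` is an idempotent. -/
def IsIdempotent (J : EJA E) (c : E) : Prop := J.jmul c c = c

/-- `c` is a primitive idempotent. -/
def IsPrimitive (J : EJA E) (c : E) : Prop :=
  J.IsIdempotent c ∧ c ≠ 0 ∧
    ∀ a b : E, J.IsIdempotent a → J.IsIdempotent b → a ≠ 0 → b ≠ 0 →
      J.jmul a b = 0 → c ≠ a + b

/-- A Jordan frame: primitive idempotents, pairwise orthogonal (w.r.t. the
Jordan product), summing to the unit. -/
def IsJordanFrame (J : EJA E) (c : Fin J.rank → E) : Prop :=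
  (∀ i, J.IsPrimitive (c i)) ∧ (∀ i j, i ≠ j → J.jmul (c i) (c j) = 0) ∧
    (∑ i, c i) = J.unit

/-- The symmetric cone: the cone of squares of the algebra. -/
def K (J : EJA E) : Set E := {z : E | ∃ y : E, z = J.jmul y y}

/-- `y` has rank `k`: some spectral decomposition of `y` has exactly `k`
nonzero eigenvalues.  (By uniqueness of eigenvalues this is well-defined.) -/
def HasRank (J : EJA E) (y : E) (k : ℕ) : Prop :=
  ∃ (c : Fin J.rank → E) (σ : Fin J.rank → ℝ),
    J.IsJordanFrame c ∧ y = ∑ i, σ i • c i ∧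
      (Finset.univ.filter (fun i => σ i ≠ 0)).card = k

/-- `t` is an eigenvalue of `y`. -/
def IsEigenvalue (J : EJA E) (y : E) (t : ℝ) : Prop :=
  ∃ (c : Fin J.rank → E) (σ : Fin J.rank → ℝ) (i : Fin J.rank),
    J.IsJordanFrame c ∧ y = ∑ j, σ j • c j ∧ σ i = t

/-- `p` is a nearest point of the symmetric cone `K` to `v`. -/
def IsProj (J : EJA E) (v p : E) : Prop :=
  p ∈ J.K ∧ ∀ z ∈ J.K, ‖v - p‖ ≤ ‖v - z‖

/-- A (linear subspace that is a) subalgebra. -/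
def IsSubalgebra (J : EJA E) (V : Submodule ℝ E) : Prop :=
  ∀ a ∈ V, ∀ b ∈ V, J.jmul a b ∈ V

/-- The algebra is simple: it is not the direct sum of two nonzero
subalgebras. -/
def IsSimple (J : EJA E) : Prop :=
  ¬ ∃ V W : Submodule ℝ E, J.IsSubalgebra V ∧ J.IsSubalgebra W ∧
      V ≠ ⊥ ∧ W ≠ ⊥ ∧ V ⊓ W = ⊥ ∧ V ⊔ W = ⊤

/-- The tangent cone of the convex set `K` at `z`:
the closure of `⋃_{t>0} t (K - z)`. -/
def tangentCone (J : EJA E) (z : E) : Set E :=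
  closure {d : E | ∃ t : ℝ, 0 < t ∧ ∃ k ∈ J.K, d = t • (k - z)}

/-- The lineality space `T_K(z) ∩ (-T_K(z))` of the tangent cone. -/
def linTangent (J : EJA E) (z : E) : Set E :=
  {d : E | d ∈ J.tangentCone z ∧ -d ∈ J.tangentCone z}

/-- The Lagrangian of problem (P1):
`L(x, μ, λ) = f(x) - ⟪h(x), μ⟫ - ⟪g(x), λ⟫`. -/
def lagr {n m : ℕ} (f : EuclideanSpace ℝ (Fin n) → ℝ)
    (h : EuclideanSpace ℝ (Fin n) → EuclideanSpace ℝ (Fin m))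
    (g : EuclideanSpace ℝ (Fin n) → E) (μ : EuclideanSpace ℝ (Fin m)) (lam : E)
    (x : EuclideanSpace ℝ (Fin n)) : ℝ :=
  f x - ⟪h x, μ⟫ - ⟪g x, lam⟫

/-- The Lagrangian of the slack-variable problem (P2), as a function of the
pair `(x, y)`. -/
def lagrSlack (J : EJA E) {n m : ℕ} (f : EuclideanSpace ℝ (Fin n) → ℝ)
    (h : EuclideanSpace ℝ (Fin n) → EuclideanSpace ℝ (Fin m))
    (g : EuclideanSpace ℝ (Fin n) → E) (μ : EuclideanSpace ℝ (Fin m)) (lam : E)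
    (p : EuclideanSpace ℝ (Fin n) × E) : ℝ :=
  f p.1 - ⟪h p.1, μ⟫ - ⟪g p.1 - J.jmul p.2 p.2, lam⟫

/-- `(x, μ, lam)` is a KKT triple of problem (P1). -/
def KKTP1 (J : EJA E) {n m : ℕ} (f : EuclideanSpace ℝ (Fin n) → ℝ)
    (h : EuclideanSpace ℝ (Fin n) → EuclideanSpace ℝ (Fin m))
    (g : EuclideanSpace ℝ (Fin n) → E)
    (x : EuclideanSpace ℝ (Fin n)) (μ : EuclideanSpace ℝ (Fin m)) (lam : E) : Prop :=
  gradient f x - (fderiv ℝ h x).adjoint μ - (fderiv ℝ g x).adjoint lam = 0 ∧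
    lam ∈ J.K ∧ g x ∈ J.K ∧ J.jmul lam (g x) = 0 ∧ h x = 0

/-- `(x, y, μ, lam)` is a KKT quadruple of the slack-variable problem (P2). -/
def KKTP2 (J : EJA E) {n m : ℕ} (f : EuclideanSpace ℝ (Fin n) → ℝ)
    (h : EuclideanSpace ℝ (Fin n) → EuclideanSpace ℝ (Fin m))
    (g : EuclideanSpace ℝ (Fin n) → E)
    (x : EuclideanSpace ℝ (Fin n)) (y : E) (μ : EuclideanSpace ℝ (Fin m))
    (lam : E) : Prop :=
  gradient f x - (fderiv ℝ h x).adjoint μ - (fderiv ℝ g x).adjoint lam = 0 ∧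
    J.jmul lam y = 0 ∧ g x = J.jmul y y ∧ h x = 0

/-- The augmented Lagrangian of the slack-variable problem (P2). -/
def augSlack (J : EJA E) {n m : ℕ} (f : EuclideanSpace ℝ (Fin n) → ℝ)
    (h : EuclideanSpace ℝ (Fin n) → EuclideanSpace ℝ (Fin m))
    (g : EuclideanSpace ℝ (Fin n) → E) (ρ : ℝ) (μ : EuclideanSpace ℝ (Fin m))
    (lam : E) (x : EuclideanSpace ℝ (Fin n)) (y : E) : ℝ :=
  f x - ⟪h x, μ⟫ + ρ / 2 * ‖h x‖ ^ 2 - ⟪g x - J.jmul y y, lam⟫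
    + ρ / 2 * ‖g x - J.jmul y y‖ ^ 2

/-- The augmented Lagrangian of problem (P1), where `P` is the metric
projection onto the symmetric cone `K`. -/
def augSym (J : EJA E) {n m : ℕ} (f : EuclideanSpace ℝ (Fin n) → ℝ)
    (h : EuclideanSpace ℝ (Fin n) → EuclideanSpace ℝ (Fin m))
    (g : EuclideanSpace ℝ (Fin n) → E) (P : E → E) (ρ : ℝ)
    (μ : EuclideanSpace ℝ (Fin m)) (lam : E)
    (x : EuclideanSpace ℝ (Fin n)) : ℝ :=
  f x - ⟪h x, μ⟫ + ρ / 2 * ‖h x‖ ^ 2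
    + 1 / (2 * ρ) * (-‖lam‖ ^ 2 + ‖P (lam - ρ • g x)‖ ^ 2)

end EJA

open Filter Topology

theorem EJA.inner_sum_smul {E : Type*} [NormedAddCommGroup E] [InnerProductSpace ℝ E] {r : ℕ}
    {c : Fin r → E}
    (h : ∀ i j, ⟪c i, c j⟫ = if i = j then (1 : ℝ) else 0) (σ : Fin r → ℝ) (j : Fin r) :
    ⟪∑ i, σ i • c i, c j⟫ = σ j := by
  simp [sum_inner, inner_smul_left, h]

namespace EJA

variable {E : Type*} [NormedAddCommGroup E] [InnerProductSpace ℝ E]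
  [FiniteDimensional ℝ E] (J : EJA E)

/-- Multiplication by an idempotent satisfies `2 L³ - 3 L² + L = 0`. -/
theorem idempotent_cubic {c : E} (hc : J.jmul c c = c) (w : E) :
    (2 : ℝ) • J.jmul c (J.jmul c (J.jmul c w)) = (3 : ℝ) • J.jmul c (J.jmul c w) - J.jmul c w := by
  have h1 := J.jordan (c + w) c
  have h2 := J.jordan (c - w) c
  have h3 := J.jordan w c
  simp only [map_add, map_sub, LinearMap.add_apply, LinearMap.sub_apply, hc, J.comm w c,
    J.comm (J.jmul c w) c, J.comm (J.jmul w w) c,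
    J.comm w (J.jmul c (J.jmul c w)), J.comm w (J.jmul c (J.jmul w w))] at h1 h2 h3
  have h4 := congrArg₂ (· - ·) h1 h2
  rw [← sub_eq_zero] at h3 h4 ⊢
  have : (2 : ℝ) • ((2 : ℝ) • J.jmul c (J.jmul c (J.jmul c w)) -
      ((3 : ℝ) • J.jmul c (J.jmul c w) - J.jmul c w)) = 0 := by
    rw [← h4]
    rw [sub_eq_zero] at h3
    simp only [h3]
    module
  simpa using this

theorem inner_idempotent_mul_self_eq {c : E} (hc : J.jmul c c = c) (y : E) :
    ⟪J.jmul c y, y⟫ = ‖(2 : ℝ) • J.jmul c (J.jmul c y) - J.jmul c y‖ ^ 2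
      + 8 * ‖J.jmul c y - J.jmul c (J.jmul c y)‖ ^ 2 := by
  have sym : ∀ a b, ⟪J.jmul c a, b⟫ = ⟪a, J.jmul c b⟫ := fun a b => by
    rw [J.comm c a, J.assoc_inner]
  have h3 := congrArg (fun z => ⟪z, y⟫) (J.idempotent_cubic hc y)
  have h4 := congrArg (fun z => ⟪z, y⟫) (J.idempotent_cubic hc (J.jmul c y))
  simp only [inner_smul_left, inner_sub_left, sym] at h3 h4
  simp only [← real_inner_self_eq_norm_sq, inner_sub_left, inner_sub_right, inner_smul_left,
    inner_smul_right, sym]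
  simp only [RCLike.conj_to_real] at *
  linarith

theorem inner_idempotent_mul_self_nonneg {c : E} (hc : J.jmul c c = c) (y : E) :
    0 ≤ ⟪J.jmul c y, y⟫ := by
  rw [J.inner_idempotent_mul_self_eq hc]
  positivity

theorem idempotent_mul_eq_zero {c : E} (hc : J.jmul c c = c) {y : E}
    (h : ⟪J.jmul c y, y⟫ = 0) : J.jmul c y = 0 := by
  rw [J.inner_idempotent_mul_self_eq hc] at h
  have h1 : ‖(2 : ℝ) • J.jmul c (J.jmul c y) - J.jmul c y‖ ^ 2 = 0 := by
    nlinarith [sq_nonneg ‖(2 : ℝ) • J.jmul c (J.jmul c y) - J.jmul c y‖,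
      sq_nonneg ‖J.jmul c y - J.jmul c (J.jmul c y)‖]
  have h2 : ‖J.jmul c y - J.jmul c (J.jmul c y)‖ ^ 2 = 0 := by linarith
  simp only [ne_eq, OfNat.ofNat_ne_zero, not_false_eq_true, pow_eq_zero_iff, norm_eq_zero] at h1 h2
  calc J.jmul c y = ((2 : ℝ) • J.jmul c (J.jmul c y) - J.jmul c y)
        + (2 : ℝ) • (J.jmul c y - J.jmul c (J.jmul c y)) := by module
    _ = 0 := by simp [h1, h2]

theorem inner_mul_self_left (c y : E) : ⟪c, J.jmul y y⟫ = ⟪J.jmul c y, y⟫ :=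
  (J.assoc_inner c y y).symm

/-- Spectral decomposition along an orthonormal system of pairwise orthogonal idempotents. -/
theorem exists_spectral (y : E) : ∃ (c : Fin J.rank → E) (σ : Fin J.rank → ℝ),
    (∀ i, J.jmul (c i) (c i) = c i) ∧ (∀ i j, i ≠ j → J.jmul (c i) (c j) = 0) ∧
    (∀ i j, ⟪c i, c j⟫ = if i = j then 1 else 0) ∧ y = ∑ i, σ i • c i := by
  obtain ⟨c, σ, h1, h2, h3, h4, -, h6⟩ := J.spectral y
  refine ⟨c, σ, h1, h4, fun i j => ?_, h6⟩
  split_ifs with hij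
  · subst hij
    exact J.inner_primitive _ (h1 i) (h2 i) (h3 i)
  · rw [← h1 i, J.assoc_inner, h4 i j hij, inner_zero_right]

theorem sum_smul_mul {c : Fin J.rank → E} (h1 : ∀ i, J.jmul (c i) (c i) = c i)
    (h2 : ∀ i j, i ≠ j → J.jmul (c i) (c j) = 0) (σ τ : Fin J.rank → ℝ) :
    J.jmul (∑ i, σ i • c i) (∑ i, τ i • c i) = ∑ i, (σ i * τ i) • c i := by
  simp only [map_sum, LinearMap.sum_apply, map_smul, LinearMap.smul_apply]
  refine Finset.sum_congr rfl fun i _ => ?_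
  rw [Finset.sum_eq_single i]
  · rw [h1, smul_smul, mul_comm]
  · intro j _ hj
    rw [h2 j i hj]
    simp
  · simp

/-- The symmetric cone is the dual of the set of idempotents. -/
theorem mem_K_iff {y : E} : y ∈ J.K ↔ ∀ c, J.jmul c c = c → 0 ≤ ⟪c, y⟫ := by
  constructor
  · rintro ⟨z, rfl⟩ c hc
    rw [J.inner_mul_self_left]
    exact J.inner_idempotent_mul_self_nonneg hc z
  · intro h
    obtain ⟨c, σ, h1, h2, h3, rfl⟩ := J.exists_spectral y
    refine ⟨∑ i, √(σ i) • c i, ?_⟩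
    rw [J.sum_smul_mul h1 h2]
    refine Finset.sum_congr rfl fun i _ => ?_
    rw [Real.mul_self_sqrt]
    have := h (c i) (h1 i)
    rwa [real_inner_comm, inner_sum_smul h3] at this

theorem isClosed_K : IsClosed J.K := by
  have : J.K = ⋂ (c : E) (_ : J.jmul c c = c), {y | 0 ≤ ⟪c, y⟫} := by
    ext y
    simp [J.mem_K_iff]
  rw [this]
  exact isClosed_biInter fun c _ => isClosed_le continuous_const (by fun_prop)

theorem smul_mem_K {t : ℝ} (ht : 0 ≤ t) {y : E} (hy : y ∈ J.K) : t • y ∈ J.K := by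
  rw [mem_K_iff] at *
  intro c hc
  rw [inner_smul_right]
  exact mul_nonneg ht (hy c hc)

theorem sum_smul_mem_K {c : Fin J.rank → E} (h1 : ∀ i, J.jmul (c i) (c i) = c i)
    {σ : Fin J.rank → ℝ} (hσ : ∀ i, 0 ≤ σ i) : ∑ i, σ i • c i ∈ J.K := by
  rw [mem_K_iff]
  intro d hd
  rw [inner_sum]
  refine Finset.sum_nonneg fun i _ => ?_
  rw [inner_smul_right]
  exact mul_nonneg (hσ i) (J.mem_K_iff.1 ⟨c i, (h1 i).symm⟩ d hd)

/-- Spectral decomposition of an element of the cone. -/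
theorem exists_spectral_of_mem_K {y : E} (hy : y ∈ J.K) :
    ∃ (c : Fin J.rank → E) (σ : Fin J.rank → ℝ), (∀ i, 0 ≤ σ i) ∧
    (∀ i, J.jmul (c i) (c i) = c i) ∧ (∀ i j, i ≠ j → J.jmul (c i) (c j) = 0) ∧
    (∀ i j, ⟪c i, c j⟫ = if i = j then 1 else 0) ∧ y = ∑ i, σ i • c i := by
  obtain ⟨c, σ, h1, h2, h3, rfl⟩ := J.exists_spectral y
  refine ⟨c, σ, fun i => ?_, h1, h2, h3, rfl⟩
  have := J.mem_K_iff.1 hy (c i) (h1 i)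
  rwa [real_inner_comm, inner_sum_smul h3] at this

theorem inner_nonneg_of_mem_K {y z : E} (hy : y ∈ J.K) (hz : z ∈ J.K) : 0 ≤ ⟪y, z⟫ := by
  obtain ⟨c, σ, h0, h1, h2, h3, rfl⟩ := J.exists_spectral_of_mem_K hy
  rw [sum_inner]
  refine Finset.sum_nonneg fun i _ => ?_
  rw [inner_smul_left]
  exact mul_nonneg (h0 i) (J.mem_K_iff.1 hz _ (h1 i))

/-- If `y ∈ K` is orthogonal to `z²`, then `y ∘ z = 0`. -/
theorem mul_eq_zero_of_inner_sq {y z : E} (hy : y ∈ J.K) (h : ⟪y, J.jmul z z⟫ = 0) :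
    J.jmul y z = 0 := by
  obtain ⟨c, σ, h0, h1, h2, h3, rfl⟩ := J.exists_spectral_of_mem_K hy
  simp only [sum_inner, inner_smul_left, RCLike.conj_to_real] at h
  rw [Finset.sum_eq_zero_iff_of_nonneg (fun i _ => mul_nonneg (h0 i)
    (J.mem_K_iff.1 ⟨z, rfl⟩ _ (h1 i)))] at h
  simp only [map_sum, LinearMap.sum_apply, map_smul, LinearMap.smul_apply]
  refine Finset.sum_eq_zero fun i hi => ?_
  rcases mul_eq_zero.1 (h i hi) with h' | h'
  · simp [h']
  · rw [J.inner_mul_self_left] at h'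
    simp [J.idempotent_mul_eq_zero (h1 i) h']

/-- If `y ∈ K` is orthogonal to `w²`, then `y` is orthogonal to every idempotent that carries
a nonzero eigenvalue of `w`. -/
theorem inner_eigen_eq_zero {c : Fin J.rank → E} {σ : Fin J.rank → ℝ}
    (h1 : ∀ i, J.jmul (c i) (c i) = c i) (h2 : ∀ i j, i ≠ j → J.jmul (c i) (c j) = 0)
    {y : E} (hy : y ∈ J.K) (h : ⟪y, J.jmul (∑ i, σ i • c i) (∑ i, σ i • c i)⟫ = 0)
    (i : Fin J.rank) : σ i = 0 ∨ ⟪c i, y⟫ = 0 := by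
  rw [J.sum_smul_mul h1 h2, real_inner_comm] at h
  simp only [sum_inner, inner_smul_left, RCLike.conj_to_real] at h
  rw [Finset.sum_eq_zero_iff_of_nonneg (fun i _ => mul_nonneg (mul_self_nonneg _)
    (J.mem_K_iff.1 hy _ (h1 i)))] at h
  simpa using h i (Finset.mem_univ i)

/-- Square roots in the cone are unique. -/
theorem eq_of_sq_eq {y z : E} (hy : y ∈ J.K) (hz : z ∈ J.K) (h : J.jmul y y = J.jmul z z) :
    y = z := by
  have h0 : J.jmul (y + z) (y - z) = 0 := by
    simp only [map_add, map_sub, LinearMap.add_apply, h, J.comm y z]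
    abel
  have hsum : ⟪y, J.jmul (y - z) (y - z)⟫ + ⟪z, J.jmul (y - z) (y - z)⟫ = 0 := by
    rw [← inner_add_left, J.inner_mul_self_left, h0, inner_zero_left]
  have hy' := J.inner_nonneg_of_mem_K hy ⟨y - z, rfl⟩
  have hz' := J.inner_nonneg_of_mem_K hz ⟨y - z, rfl⟩
  obtain ⟨c, σ, h1, h2, h3, hw⟩ := J.exists_spectral (y - z)
  have hy0 : ⟪y, J.jmul (y - z) (y - z)⟫ = 0 := by linarith
  have hz0 : ⟪z, J.jmul (y - z) (y - z)⟫ = 0 := by linarith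
  rw [hw] at hy0 hz0
  rw [← sub_eq_zero, hw]
  refine Finset.sum_eq_zero fun i _ => ?_
  have hi : σ i = ⟪c i, y⟫ - ⟪c i, z⟫ := by
    rw [← inner_sub_right, hw, real_inner_comm, inner_sum_smul h3]
  rcases J.inner_eigen_eq_zero h1 h2 hy hy0 i with h' | h'
  · simp [h']
  · rcases J.inner_eigen_eq_zero h1 h2 hz hz0 i with h'' | h''
    · simp [h'']
    · simp [hi, h', h'']

theorem norm_sq_le_of_sq (y : E) : ‖y‖ ^ 2 ≤ ‖J.jmul y y‖ * ‖J.unit‖ := by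
  have : ⟪y, y⟫ = ⟪J.jmul y y, J.unit⟫ := by
    rw [J.assoc_inner, J.comm y J.unit, J.unit_jmul]
  rw [← real_inner_self_eq_norm_sq, this]
  exact real_inner_le_norm _ _

/-- Elements annihilated by `s ∈ K` are orthogonal to the lineality space of the tangent cone
at `s²`. -/
theorem inner_linTangent_eq_zero {s w u : E} (hs : s ∈ J.K) (h : J.jmul s w = 0)
    (hu : u ∈ J.linTangent (J.jmul s s)) : ⟪w, u⟫ = 0 := by
  have hsw : ⟪s, J.jmul w w⟫ = 0 := by rw [J.inner_mul_self_left, h, inner_zero_left]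
  obtain ⟨c, σ, h1, h2, h3, rfl⟩ := J.exists_spectral w
  rw [sum_inner]
  refine Finset.sum_eq_zero fun i _ => ?_
  rw [inner_smul_left]
  rcases J.inner_eigen_eq_zero h1 h2 hs hsw i with h' | h'
  · simp [h']
  have hss : ⟪c i, J.jmul s s⟫ = 0 := by
    rw [← h1 i, real_inner_comm] at h'
    have := J.mul_eq_zero_of_inner_sq hs h'
    rw [J.inner_mul_self_left, J.comm, this, inner_zero_left]
  have key : ∀ d ∈ J.tangentCone (J.jmul s s), 0 ≤ ⟪c i, d⟫ := by
    intro d hd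
    have hcl : IsClosed {d : E | 0 ≤ ⟪c i, d⟫} := isClosed_le continuous_const (by fun_prop)
    refine closure_minimal ?_ hcl hd
    rintro _ ⟨t, ht, k, hk, rfl⟩
    rw [Set.mem_ofPred_eq, inner_smul_right, inner_sub_right, hss, sub_zero]
    exact mul_nonneg ht.le (J.mem_K_iff.1 hk _ (h1 i))
  have k1 := key _ hu.1
  have k2 := key _ hu.2
  rw [inner_neg_right] at k2
  rw [le_antisymm (by linarith) k1, mul_zero]

/-- Moreau decomposition for the metric projection onto the symmetric cone. -/
theorem IsProj.moreau {v p : E} (hp : J.IsProj v p) :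
    (∃ y ∈ J.K, J.jmul y y = p - v) ∧ ⟪p, p - v⟫ = 0 := by
  obtain ⟨c, σ, h1, h2, h3, rfl⟩ := J.exists_spectral v
  set q := ∑ i, max (σ i) 0 • c i with hq
  have hqK : q ∈ J.K := J.sum_smul_mem_K h1 fun i => le_max_right _ _
  have hdiff : q - ∑ i, σ i • c i = ∑ i, max (-σ i) 0 • c i := by
    rw [hq, ← Finset.sum_sub_distrib]
    refine Finset.sum_congr rfl fun i _ => ?_
    rw [← sub_smul]
    congr 1
    rcases le_total (σ i) 0 with h | h
    · rw [max_eq_right h, max_eq_left (by linarith)]; ring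
    · rw [max_eq_left h, max_eq_right (by linarith)]; ring
  have horth : ⟪q, q - ∑ i, σ i • c i⟫ = 0 := by
    rw [hdiff, inner_sum]
    refine Finset.sum_eq_zero fun i _ => ?_
    rw [inner_smul_right, hq, inner_sum_smul h3]
    rcases le_total (σ i) 0 with h | h
    · rw [max_eq_right h, mul_zero]
    · rw [max_eq_right (by linarith : -σ i ≤ 0), zero_mul]
  have hdK : q - ∑ i, σ i • c i ∈ J.K := by
    rw [hdiff]
    exact J.sum_smul_mem_K h1 fun i => le_max_right _ _
  have hpq : p = q := by
    have hle := hp.2 q hqK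
    have hnn := J.inner_nonneg_of_mem_K hp.1 hdK
    set v := ∑ i, σ i • c i
    have e : ‖v - p‖ ^ 2 = ‖v - q‖ ^ 2 + ‖p - q‖ ^ 2 + 2 * (⟪p, q - v⟫ - ⟪q, q - v⟫) := by
      rw [← inner_sub_left, show v - p = (v - q) - (p - q) by abel, norm_sub_sq_real,
        ← neg_sub q v, inner_neg_left, real_inner_comm]
      ring
    have hsq : ‖v - p‖ ^ 2 ≤ ‖v - q‖ ^ 2 := by gcongr
    have : ‖p - q‖ ^ 2 = 0 := by nlinarith [sq_nonneg ‖p - q‖]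
    simpa [sub_eq_zero] using this
  rw [hpq]
  refine ⟨⟨∑ i, √(max (-σ i) 0) • c i, J.sum_smul_mem_K h1 fun i => Real.sqrt_nonneg _, ?_⟩,
    horth⟩
  rw [J.sum_smul_mul h1 h2, hdiff]
  refine Finset.sum_congr rfl fun i _ => ?_
  rw [Real.mul_self_sqrt (le_max_right _ _)]

end EJA

section EqualityConstrained

variable {Z Y : Type*} [NormedAddCommGroup Z] [NormedSpace ℝ Z]
  [NormedAddCommGroup Y] [InnerProductSpace ℝ Y]

/-- A function of class `C²` with vanishing derivative at `a` increases strictly along rays in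
directions close to one of positive curvature. -/
theorem eventually_lt_of_second_deriv_pos {l : Z → ℝ} (hl : ContDiff ℝ 2 l) {a u : Z}
    (h0 : fderiv ℝ l a = 0) (hpos : 0 < fderiv ℝ (fderiv ℝ l) a u u) :
    ∀ᶠ q : ℝ × Z in 𝓝 (0, u), 0 < q.1 → l a < l (a + q.1 • q.2) := by
  have hd1 : ContDiff ℝ 1 (fderiv ℝ l) := hl.fderiv_right (by norm_num)
  have hd : Continuous (fderiv ℝ (fderiv ℝ l)) := hd1.continuous_fderiv one_ne_zero
  have hcont : Continuous fun q : ℝ × Z =>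
      fderiv ℝ (fderiv ℝ l) (a + q.1 • q.2) q.2 q.2 := by fun_prop
  have hev : ∀ᶠ q : ℝ × Z in 𝓝 (0, u), 0 < fderiv ℝ (fderiv ℝ l) (a + q.1 • q.2) q.2 q.2 := by
    refine hcont.continuousAt.eventually_const_lt ?_
    simpa using hpos
  rw [Metric.eventually_nhds_iff_ball] at hev ⊢
  obtain ⟨r, hr, hball⟩ := hev
  refine ⟨r, hr, ?_⟩
  rintro ⟨t, w⟩ hq ht
  simp only at ht ⊢
  have hmem : ∀ τ ∈ Set.Icc 0 t, (τ, w) ∈ Metric.ball ((0 : ℝ), u) r := by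
    intro τ hτ
    simp only [Metric.mem_ball, Prod.dist_eq, max_lt_iff, dist_zero_right, Real.norm_eq_abs] at hq ⊢
    exact ⟨by rw [abs_of_nonneg hτ.1]; rw [abs_of_pos ht] at hq; linarith [hτ.2, hq.1], hq.2⟩
  have hline : ∀ τ : ℝ, HasDerivAt (fun τ : ℝ => a + τ • w) w τ := fun τ => by
    simpa using ((hasDerivAt_id τ).smul_const w).const_add a
  have hD1 : ∀ τ : ℝ, HasDerivAt (fun τ : ℝ => l (a + τ • w)) (fderiv ℝ l (a + τ • w) w) τ :=
    fun τ => ((hl.differentiable two_ne_zero) _).hasFDerivAt.comp_hasDerivAt τ (hline τ)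
  have hD2 : ∀ τ : ℝ, HasDerivAt (fun τ : ℝ => fderiv ℝ l (a + τ • w) w)
      (fderiv ℝ (fderiv ℝ l) (a + τ • w) w w) τ := fun τ => by
    have h1 := ((hd1.differentiable one_ne_zero) _).hasFDerivAt.comp_hasDerivAt τ (hline τ)
    simpa using h1.clm_apply (hasDerivAt_const τ w)
  have hmono : StrictMonoOn (fun τ : ℝ => fderiv ℝ l (a + τ • w) w) (Set.Icc 0 t) := by
    refine strictMonoOn_of_deriv_pos (convex_Icc 0 t)
      (fun τ _ => (hD2 τ).continuousAt.continuousWithinAt) fun τ hτ => ?_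
    rw [interior_Icc] at hτ
    rw [(hD2 τ).deriv]
    exact hball _ (hmem τ ⟨hτ.1.le, hτ.2.le⟩)
  have hmono' : StrictMonoOn (fun τ : ℝ => l (a + τ • w)) (Set.Icc 0 t) := by
    refine strictMonoOn_of_deriv_pos (convex_Icc 0 t)
      (fun τ _ => (hD1 τ).continuousAt.continuousWithinAt) fun τ hτ => ?_
    rw [interior_Icc] at hτ
    rw [(hD1 τ).deriv]
    have := hmono ⟨le_rfl, ht.le⟩ ⟨hτ.1.le, hτ.2.le⟩ hτ.1
    simpa [h0] using this
  simpa using hmono' ⟨le_rfl, ht.le⟩ ⟨ht.le, le_rfl⟩ ht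

theorem eventually_ne_zero_of_fderiv_ne_zero {H : Z → Y} (hH : ContDiff ℝ 1 H) {a u : Z}
    (h0 : H a = 0) (hu : fderiv ℝ H a u ≠ 0) :
    ∀ᶠ q : ℝ × Z in 𝓝 (0, u), 0 < q.1 → H (a + q.1 • q.2) ≠ 0 := by
  have hs : HasStrictFDerivAt H (fderiv ℝ H a) a :=
    hH.contDiffAt.hasStrictFDerivAt one_ne_zero
  have hpos : 0 < ‖fderiv ℝ H a u‖ := norm_pos_iff.2 hu
  set c := ‖fderiv ℝ H a u‖ / (2 * (‖u‖ + 1)) with hc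
  have hcpos : 0 < c := by positivity
  have hcu : c * ‖u‖ < ‖fderiv ℝ H a u‖ := by
    rw [hc, div_mul_eq_mul_div, div_lt_iff₀ (by positivity)]
    nlinarith [norm_nonneg u]
  have h1 : ∀ᶠ q : ℝ × Z in 𝓝 (0, u), c * ‖q.2‖ < ‖fderiv ℝ H a q.2‖ :=
    ContinuousAt.eventually_lt (f := fun q : ℝ × Z => c * ‖q.2‖)
      (g := fun q : ℝ × Z => ‖fderiv ℝ H a q.2‖) (by fun_prop) (by fun_prop) hcu
  have ht : Tendsto (fun q : ℝ × Z => a + q.1 • q.2) (𝓝 (0, u)) (𝓝 a) := by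
    have : Continuous fun q : ℝ × Z => a + q.1 • q.2 := by fun_prop
    simpa using this.tendsto (0, u)
  have h2 := ht.eventually (hs.hasFDerivAt.isLittleO.def hcpos)
  filter_upwards [h1, h2] with q hq1 hq2 hq hzero
  simp only [hzero, h0, sub_self, add_sub_cancel_left, zero_sub, norm_neg, map_smul,
    norm_smul, Real.norm_eq_abs, abs_of_pos hq] at hq2
  nlinarith

/-- Second-order sufficiency: a stationary point satisfying the second-order condition is a strict
local minimizer. -/
theorem strict_local_min_of_sosc [FiniteDimensional ℝ Z] {F : Z → ℝ} {H : Z → Y}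
    (hF : ContDiff ℝ 2 F)
    (hH : ContDiff ℝ 2 H) {zs : Z} {νs : Y} (hfeas : H zs = 0)
    (hstat : ∀ v, fderiv ℝ F zs v = ⟪νs, fderiv ℝ H zs v⟫)
    (hsosc : ∀ v, v ≠ 0 → fderiv ℝ H zs v = 0 →
      0 < fderiv ℝ (fderiv ℝ (fun z => F z - ⟪νs, H z⟫)) zs v v) :
    ∀ᶠ z in 𝓝 zs, H z = 0 → z ≠ zs → F zs < F z := by
  have hl : ContDiff ℝ 2 (fun z => F z - ⟪νs, H z⟫) := hF.sub (contDiff_const.inner ℝ hH)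
  have hl0 : fderiv ℝ (fun z => F z - ⟪νs, H z⟫) zs = 0 := by
    ext v
    have hdF := (hF.differentiable two_ne_zero) zs
    have hdH := (hH.differentiable two_ne_zero) zs
    rw [fderiv_fun_sub hdF ((differentiableAt_const _).inner ℝ hdH)]
    simp [fderiv_inner_apply ℝ (differentiableAt_const νs) hdH, hstat]
  have key : ∀ᶠ t : ℝ in 𝓝 0, ∀ u ∈ Metric.sphere (0 : Z) 1,
      0 < t → H (zs + t • u) = 0 → F zs < F (zs + t • u) := by
    refine (isCompact_sphere (0 : Z) 1).eventually_forall_of_forall_eventually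
      (P := fun t u => 0 < t → H (zs + t • u) = 0 → F zs < F (zs + t • u)) fun u hu => ?_
    have hu0 : u ≠ 0 := by
      rintro rfl
      simp at hu
    by_cases hDu : fderiv ℝ H zs u = 0
    · filter_upwards [eventually_lt_of_second_deriv_pos hl hl0 (hsosc u hu0 hDu)] with q hq h1 h2
      simpa [hfeas, h2] using hq h1
    · filter_upwards [eventually_ne_zero_of_fderiv_ne_zero (hH.of_le one_le_two) hfeas hDu]
        with q hq h1 h2
      exact absurd h2 (hq h1)
  have ht : Tendsto (fun z => ‖z - zs‖) (𝓝 zs) (𝓝 0) := by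
    have : Continuous fun z => ‖z - zs‖ := by fun_prop
    simpa using this.tendsto zs
  filter_upwards [ht.eventually key] with z hz hHz hne
  have hn : 0 < ‖z - zs‖ := norm_pos_iff.2 (sub_ne_zero.2 hne)
  have heq : zs + ‖z - zs‖ • (‖z - zs‖⁻¹ • (z - zs)) = z := by
    rw [smul_smul, mul_inv_cancel₀ hn.ne', one_smul]
    abel
  have := hz (‖z - zs‖⁻¹ • (z - zs)) (by simp [norm_smul, hn.ne']) hn
  rw [heq] at this
  exact this hHz

/-- Multipliers of stationary points near a point satisfying the linear independence constraint
qualification are close to the multiplier at that point. -/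
theorem tendsto_multiplier [FiniteDimensional ℝ Y] {F : Z → ℝ} {H : Z → Y} (hF : ContDiff ℝ 2 F)
    (hH : ContDiff ℝ 2 H) {zs : Z} {νs : Y}
    (hstat : ∀ v, fderiv ℝ F zs v = ⟪νs, fderiv ℝ H zs v⟫)
    (hlicq : ∀ ν : Y, (∀ v, ⟪ν, fderiv ℝ H zs v⟫ = 0) → ν = 0) {η : ℝ} (hη : 0 < η) :
    ∀ᶠ z in 𝓝 zs, ∀ ν : Y, (∀ v, fderiv ℝ F z v = ⟪ν, fderiv ℝ H z v⟫) → ‖ν - νs‖ < η := by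
  have hcF : Continuous (fderiv ℝ F) := hF.continuous_fderiv two_ne_zero
  have hcH : Continuous (fderiv ℝ H) := hH.continuous_fderiv two_ne_zero
  let T : Y →ₗ[ℝ] (Z →L[ℝ] ℝ) :=
    { toFun := fun ν => (innerSL ℝ ν).comp (fderiv ℝ H zs)
      map_add' := fun a b => by ext; simp
      map_smul' := fun a b => by ext; simp }
  have hT : LinearMap.ker T = ⊥ := by
    rw [LinearMap.ker_eq_bot']
    intro ν hν
    refine hlicq ν fun v => ?_
    simpa [T] using congrArg (fun φ : Z →L[ℝ] ℝ => φ v) hν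
  obtain ⟨c, hc, hanti⟩ := T.exists_antilipschitzWith hT
  have hbound : ∀ ν, ‖ν‖ ≤ c * ‖(innerSL ℝ ν).comp (fderiv ℝ H zs)‖ := fun ν =>
    hanti.le_mul_norm (map_zero T) ν
  have hc' : (0 : ℝ) < c := hc
  have h1 : ∀ᶠ z in 𝓝 zs, c * ‖fderiv ℝ H z - fderiv ℝ H zs‖ < 1 / 2 := by
    have : Continuous fun z => c * ‖fderiv ℝ H z - fderiv ℝ H zs‖ := by fun_prop
    exact this.continuousAt.eventually_lt_const (by simp)
  have h2 : ∀ᶠ z in 𝓝 zs,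
      c * ‖fderiv ℝ F z - (innerSL ℝ νs).comp (fderiv ℝ H z)‖ < η / 2 := by
    have : Continuous fun z => c * ‖fderiv ℝ F z - (innerSL ℝ νs).comp (fderiv ℝ H z)‖ := by
      fun_prop
    refine this.continuousAt.eventually_lt_const ?_
    have : fderiv ℝ F zs - (innerSL ℝ νs).comp (fderiv ℝ H zs) = 0 := by
      ext v
      simp [hstat]
    simpa [this] using hη
  filter_upwards [h1, h2] with z hz1 hz2 ν hν
  have hb := hbound (ν - νs)
  have e : (innerSL ℝ (ν - νs)).comp (fderiv ℝ H zs)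
      = (fderiv ℝ F z - (innerSL ℝ νs).comp (fderiv ℝ H z))
        - (innerSL ℝ (ν - νs)).comp (fderiv ℝ H z - fderiv ℝ H zs) := by
    ext v
    simp only [ContinuousLinearMap.comp_apply, sub_apply, hν v,
      innerSL_apply_apply, inner_sub_left, inner_sub_right]
    ring
  have hn : ‖(innerSL ℝ (ν - νs)).comp (fderiv ℝ H z - fderiv ℝ H zs)‖
      ≤ ‖ν - νs‖ * ‖fderiv ℝ H z - fderiv ℝ H zs‖ := by
    refine (ContinuousLinearMap.opNorm_comp_le _ _).trans ?_
    rw [innerSL_apply_norm]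
  rw [e] at hb
  have hb' := hb.trans (mul_le_mul_of_nonneg_left ((norm_sub_le _ _).trans
    (add_le_add_right hn _)) hc'.le)
  nlinarith [norm_nonneg (ν - νs)]

/-- The perturbed optimality system of an equality constrained problem has a unique local solution,
which depends continuously differentiably on the perturbation. -/
theorem exists_implicit_kkt [FiniteDimensional ℝ Z] [FiniteDimensional ℝ Y]
    {F : Z → ℝ} {H : Z → Y} (hF : ContDiff ℝ 2 F)
    (hH : ContDiff ℝ 2 H) {zs : Z} {νs : Y} (hfeas : H zs = 0)
    (hstat : ∀ v, fderiv ℝ F zs v = ⟪νs, fderiv ℝ H zs v⟫)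
    (hsosc : ∀ v, v ≠ 0 → fderiv ℝ H zs v = 0 →
      0 < fderiv ℝ (fderiv ℝ (fun z => F z - ⟪νs, H z⟫)) zs v v)
    (hlicq : ∀ ν : Y, (∀ v, ⟪ν, fderiv ℝ H zs v⟫ = 0) → ν = 0) :
    ∃ Φ : Y × ℝ → Z × Y, ContDiffAt ℝ 1 Φ 0 ∧ Φ 0 = (zs, νs) ∧
      (∀ᶠ p in 𝓝 (0 : Y × ℝ), H (Φ p).1 - p.1 + p.2 • ((Φ p).2 - νs) = 0) ∧
      ∀ᶠ w in 𝓝 ((0 : Y × ℝ), (zs, νs)),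
        (∀ v, fderiv ℝ F w.2.1 v = ⟪w.2.2, fderiv ℝ H w.2.1 v⟫) →
        H w.2.1 - w.1.1 + w.1.2 • (w.2.2 - νs) = 0 → Φ w.1 = w.2 := by
  set l : Z → ℝ := fun z => F z - ⟪νs, H z⟫ with hldef
  have hl : ContDiff ℝ 2 l := hF.sub (contDiff_const.inner ℝ hH)
  have hdl (z v : Z) : fderiv ℝ l z v = fderiv ℝ F z v - ⟪νs, fderiv ℝ H z v⟫ := by
    have hdF := (hF.differentiable two_ne_zero) z
    have hdH := (hH.differentiable two_ne_zero) z
    rw [hldef, fderiv_fun_sub hdF ((differentiableAt_const _).inner ℝ hdH)]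
    simp [fderiv_inner_apply ℝ (differentiableAt_const νs) hdH]
  have hDl : ContDiff ℝ 1 (fderiv ℝ l) := hl.fderiv_right (by norm_num)
  have hDH : ContDiff ℝ 1 (fderiv ℝ H) := hH.fderiv_right (by norm_num)
  have hH1 : ContDiff ℝ 1 H := hH.of_le one_le_two
  let Θ : (Y × ℝ) × (Z × Y) → (Z →L[ℝ] ℝ) × Y := fun w =>
    (fderiv ℝ l w.2.1 - (innerSL ℝ (w.2.2 - νs)).comp (fderiv ℝ H w.2.1),
      H w.2.1 - w.1.1 + w.1.2 • (w.2.2 - νs))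
  set u : (Y × ℝ) × (Z × Y) := (0, (zs, νs)) with hu
  have hΘ : ContDiff ℝ 1 Θ := by
    refine ContDiff.prodMk (ContDiff.sub (by fun_prop) (ContDiff.clm_comp ?_ (by fun_prop)))
      (by fun_prop)
    exact (innerSL ℝ (E := Y)).contDiff.comp (by fun_prop)
  have hΘu : Θ u = 0 := by
    have : fderiv ℝ l zs = 0 := by
      ext v
      simp [hdl, hstat]
    simp [Θ, u, this, hfeas]
  have hpart (v : Z) (η : Y) : (fderiv ℝ Θ u) (0, (v, η)) =
      (fderiv ℝ (fderiv ℝ l) zs v - (innerSL ℝ η).comp (fderiv ℝ H zs), fderiv ℝ H zs v) := by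
    have hc : HasDerivAt (fun t : ℝ => u + t • ((0 : Y × ℝ), (v, η))) (0, (v, η)) 0 := by
      simpa using ((hasDerivAt_id (0 : ℝ)).smul_const ((0 : Y × ℝ), (v, η))).const_add u
    have h1 : HasDerivAt (fun t : ℝ => Θ (u + t • ((0 : Y × ℝ), (v, η))))
        (fderiv ℝ Θ u (0, (v, η))) 0 := by
      have := (hΘ.differentiable one_ne_zero (u + (0 : ℝ) • ((0 : Y × ℝ), (v, η)))).hasFDerivAt
      simpa [Function.comp_def] using this.comp_hasDerivAt (0 : ℝ) hc
    have hz : HasDerivAt (fun t : ℝ => zs + t • v) v 0 := by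
      simpa using ((hasDerivAt_id (0 : ℝ)).smul_const v).const_add zs
    have ha : HasDerivAt (fun t : ℝ => fderiv ℝ l (zs + t • v)) (fderiv ℝ (fderiv ℝ l) zs v) 0 := by
      have := (hDl.differentiable one_ne_zero (zs + (0 : ℝ) • v)).hasFDerivAt
      simpa [Function.comp_def] using this.comp_hasDerivAt (0 : ℝ) hz
    have hb : HasDerivAt (fun t : ℝ => fderiv ℝ H (zs + t • v)) (fderiv ℝ (fderiv ℝ H) zs v) 0 := by
      have := (hDH.differentiable one_ne_zero (zs + (0 : ℝ) • v)).hasFDerivAt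
      simpa [Function.comp_def] using this.comp_hasDerivAt (0 : ℝ) hz
    have hh : HasDerivAt (fun t : ℝ => H (zs + t • v)) (fderiv ℝ H zs v) 0 := by
      have := (hH1.differentiable one_ne_zero (zs + (0 : ℝ) • v)).hasFDerivAt
      simpa [Function.comp_def] using this.comp_hasDerivAt (0 : ℝ) hz
    have hi : HasDerivAt (fun t : ℝ => t • innerSL ℝ η) (innerSL ℝ η) 0 := by
      simpa using (hasDerivAt_id (0 : ℝ)).smul_const (innerSL ℝ η)
    have h2 := (ha.sub (hi.clm_comp hb)).prodMk hh
    have h3 : (fun t : ℝ => Θ (u + t • ((0 : Y × ℝ), (v, η)))) = fun t : ℝ =>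
        (fderiv ℝ l (zs + t • v) - (t • innerSL ℝ η).comp (fderiv ℝ H (zs + t • v)),
          H (zs + t • v)) := by
      funext t
      simp [Θ, u]
    rw [h3] at h1
    simpa using h1.unique h2
  have hinv : (fderiv ℝ Θ u ∘L .inr ℝ (Y × ℝ) (Z × Y)).IsInvertible := by
    set A : Z × Y →L[ℝ] (Z →L[ℝ] ℝ) × Y := fderiv ℝ Θ u ∘L .inr ℝ (Y × ℝ) (Z × Y) with hA
    have hAapp (v : Z) (η : Y) : A (v, η) =
        (fderiv ℝ (fderiv ℝ l) zs v - (innerSL ℝ η).comp (fderiv ℝ H zs), fderiv ℝ H zs v) := by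
      rw [← hpart]
      simp [A]
    have hker : Function.Injective A := by
      rw [injective_iff_map_eq_zero]
      rintro ⟨v, η⟩ h0
      rw [hAapp, Prod.mk_eq_zero] at h0
      obtain ⟨h1, h2⟩ := h0
      have h1' : ∀ a, fderiv ℝ (fderiv ℝ l) zs v a = ⟪η, fderiv ℝ H zs a⟫ := fun a => by
        simpa [sub_eq_zero] using congrArg (fun φ : Z →L[ℝ] ℝ => φ a) h1
      have hv : v = 0 := by
        by_contra hv
        have := hsosc v hv h2
        rw [h1', h2, inner_zero_right] at this
        exact lt_irrefl _ this
      subst hv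
      have := hlicq η fun a => by rw [← h1' a]; simp
      rw [this]
      rfl
    have hfr : Module.finrank ℝ (Z × Y) = Module.finrank ℝ ((Z →L[ℝ] ℝ) × Y) := by
      rw [Module.finrank_prod, Module.finrank_prod,
        ← (LinearMap.toContinuousLinearMap (𝕜 := ℝ) (E := Z) (F' := ℝ)).finrank_eq]
      congr 1
      exact (Subspace.dual_finrank_eq (K := ℝ) (V := Z)).symm
    let e := LinearEquiv.ofInjectiveOfFinrankEq (A : Z × Y →ₗ[ℝ] (Z →L[ℝ] ℝ) × Y) hker hfr
    refine ⟨e.toContinuousLinearEquiv, ?_⟩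
    exact ContinuousLinearMap.ext fun x => rfl
  have hΘat : ContDiffAt ℝ 1 Θ u := hΘ.contDiffAt
  refine ⟨hΘat.implicitFunction one_ne_zero hinv,
    hΘat.contDiffAt_implicitFunction one_ne_zero hinv,
    hΘat.implicitFunction_apply_self one_ne_zero hinv, ?_, ?_⟩
  · filter_upwards [hΘat.eventually_apply_implicitFunction one_ne_zero hinv] with p hp
    rw [hΘu] at hp
    exact congrArg Prod.snd hp
  · filter_upwards [hΘat.eventually_apply_eq_iff_implicitFunction one_ne_zero hinv]
      with w hw h1 h2
    refine hw.1 ?_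
    rw [hΘu]
    refine Prod.ext ?_ h2
    ext v
    simp only [Θ, sub_apply, ContinuousLinearMap.comp_apply, innerSL_apply_apply,
      hdl, h1, inner_sub_left]
    simp

/-- The augmented Lagrangian, up to an additive constant, in terms of the scaled multiplier shift
`p.1` and the reciprocal `p.2` of the penalty parameter. -/
def scaledAug (F : Z → ℝ) (H : Z → Y) (νs : Y) (p : Y × ℝ) (z : Z) : ℝ :=
  F z - ⟪νs, H z⟫ + (2 * p.2)⁻¹ * ‖H z - p.1‖ ^ 2

theorem stationary_scaledAug {F : Z → ℝ} {H : Z → Y} (hF : Differentiable ℝ F)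
    (hH : Differentiable ℝ H) {νs : Y} {p : Y × ℝ} {z : Z}
    (hmin : IsLocalMin (scaledAug F H νs p) z) (v : Z) :
    fderiv ℝ F z v = ⟪νs + p.2⁻¹ • (p.1 - H z), fderiv ℝ H z v⟫ := by
  have hdF := (hF z).hasFDerivAt
  have hdH := (hH z).hasFDerivAt
  have h1 := (hdF.sub ((hasFDerivAt_const νs z).inner ℝ hdH)).add
    (((hdH.sub_const p.1).norm_sq).const_mul (2 * p.2)⁻¹)
  have h2 := congrArg (fun φ : Z →L[ℝ] ℝ => φ v) (hmin.hasFDerivAt_eq_zero h1)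
  simp at h2
  simp only [inner_add_left, inner_smul_left, inner_sub_left, RCLike.conj_to_real]
  linarith

/-- Points of a compact set at which the augmented Lagrangian is at most its value at the
solution of the perturbed system are close to the unique solution of the problem. -/
theorem eventually_mem_of_scaledAug_le {Z : Type*} [NormedAddCommGroup Z]
    {F : Z → ℝ} {H : Z → Y} (hF : Continuous F)
    (hH : Continuous H) {zs : Z} {νs : Y} (hfeas : H zs = 0) {C : Set Z} (hC : IsCompact C)
    (hmin : ∀ z ∈ C, H z = 0 → z ≠ zs → F zs < F z) {Φ : Y × ℝ → Z × Y}
    (hΦ : ContinuousAt Φ 0) (hΦ0 : Φ 0 = (zs, νs))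
    (hsol : ∀ᶠ p in 𝓝 (0 : Y × ℝ), H (Φ p).1 - p.1 + p.2 • ((Φ p).2 - νs) = 0)
    {V : Set Z} (hV : IsOpen V) (hzV : zs ∈ V) :
    ∀ᶠ p in 𝓝 (0 : Y × ℝ), ∀ z ∈ C, 0 < p.2 →
      scaledAug F H νs p z ≤ scaledAug F H νs p (Φ p).1 → z ∈ V := by
  suffices h : ∀ᶠ p in 𝓝 (0 : Y × ℝ), ∀ z ∈ C \ V, 0 < p.2 →
      ¬ scaledAug F H νs p z ≤ scaledAug F H νs p (Φ p).1 by
    filter_upwards [h] with p hp z hz h1 h2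
    by_contra hzV
    exact hp z ⟨hz, hzV⟩ h1 h2
  refine (hC.diff hV).eventually_forall_of_forall_eventually
    (P := fun p z => 0 < p.2 → ¬ scaledAug F H νs p z ≤ scaledAug F H νs p (Φ p).1)
    fun z hz => ?_
  have hsol' : ∀ᶠ q : (Y × ℝ) × Z in 𝓝 (0, z),
      H (Φ q.1).1 - q.1.1 + q.1.2 • ((Φ q.1).2 - νs) = 0 :=
    (continuous_fst.tendsto ((0 : Y × ℝ), z)).eventually hsol
  have hΦ' : ContinuousAt (fun q : (Y × ℝ) × Z => Φ q.1) (0, z) :=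
    ContinuousAt.comp (f := Prod.fst) (g := Φ) hΦ continuousAt_fst
  have hval : ∀ q : (Y × ℝ) × Z, H (Φ q.1).1 - q.1.1 + q.1.2 • ((Φ q.1).2 - νs) = 0 → 0 < q.1.2 →
      scaledAug F H νs q.1 (Φ q.1).1 =
        F (Φ q.1).1 - ⟪νs, H (Φ q.1).1⟫ + q.1.2 / 2 * ‖(Φ q.1).2 - νs‖ ^ 2 := by
    intro q hq hpos
    rw [scaledAug, eq_neg_of_add_eq_zero_left hq, norm_neg, norm_smul, Real.norm_eq_abs,
      abs_of_pos hpos]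
    field_simp
  have hΦ1 : ContinuousAt (fun q : (Y × ℝ) × Z => (Φ q.1).1) (0, z) := hΦ'.fst
  have hΦ2 : ContinuousAt (fun q : (Y × ℝ) × Z => (Φ q.1).2) (0, z) := hΦ'.snd
  have hFΦ : ContinuousAt (fun q : (Y × ℝ) × Z => F (Φ q.1).1) (0, z) :=
    hF.continuousAt.comp hΦ1
  have hHΦ : ContinuousAt (fun q : (Y × ℝ) × Z => H (Φ q.1).1) (0, z) :=
    hH.continuousAt.comp hΦ1
  have hR : ContinuousAt (fun q : (Y × ℝ) × Z =>
      F (Φ q.1).1 - ⟪νs, H (Φ q.1).1⟫ + q.1.2 / 2 * ‖(Φ q.1).2 - νs‖ ^ 2) (0, z) := by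
    fun_prop
  have hB : ContinuousAt (fun q : (Y × ℝ) × Z => F q.2 - ⟪νs, H q.2⟫) (0, z) := by
    fun_prop
  by_cases hHz : H z = 0
  · have hlt := hmin z hz.1 hHz (by rintro rfl; exact hz.2 hzV)
    have := hR.eventually_lt hB (by simpa [hΦ0, hfeas, hHz] using hlt)
    filter_upwards [this, hsol'] with q h1 h2 h3
    rw [hval q h2 h3, scaledAug, not_le]
    have : 0 ≤ (2 * q.1.2)⁻¹ * ‖H q.2 - q.1.1‖ ^ 2 := by positivity
    linarith
  · have hS : ContinuousAt (fun q : (Y × ℝ) × Z => 2 * q.1.2 *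
        ((F (Φ q.1).1 - ⟪νs, H (Φ q.1).1⟫ + q.1.2 / 2 * ‖(Φ q.1).2 - νs‖ ^ 2)
          - (F q.2 - ⟪νs, H q.2⟫))) (0, z) := by fun_prop
    have hN : ContinuousAt (fun q : (Y × ℝ) × Z => ‖H q.2 - q.1.1‖ ^ 2) (0, z) := by fun_prop
    have := hS.eventually_lt hN (by
      simpa only [Prod.fst_zero, Prod.snd_zero, mul_zero, zero_mul, sub_zero] using
        pow_pos (norm_pos_iff.2 hHz) 2)
    filter_upwards [this, hsol'] with q h1 h2 h3
    rw [hval q h2 h3, scaledAug, not_le]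
    have h1 := (lt_div_iff₀' (by positivity : (0 : ℝ) < 2 * q.1.2)).2 h1
    rw [div_eq_inv_mul (‖H q.2 - q.1.1‖ ^ 2)] at h1
    linarith

/-- Local convergence theory of the method of multipliers for an equality constrained problem. -/
theorem eventually_scaledAug_minimizer [FiniteDimensional ℝ Z] [FiniteDimensional ℝ Y]
    {F : Z → ℝ} {H : Z → Y} (hF : ContDiff ℝ 2 F)
    (hH : ContDiff ℝ 2 H) {zs : Z} {νs : Y} (hfeas : H zs = 0)
    (hstat : ∀ v, fderiv ℝ F zs v = ⟪νs, fderiv ℝ H zs v⟫)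
    (hsosc : ∀ v, v ≠ 0 → fderiv ℝ H zs v = 0 →
      0 < fderiv ℝ (fderiv ℝ (fun z => F z - ⟪νs, H z⟫)) zs v v)
    (hlicq : ∀ ν : Y, (∀ v, ⟪ν, fderiv ℝ H zs v⟫ = 0) → ν = 0)
    {C : Set Z} (hC : IsCompact C) (hmin : ∀ z ∈ C, H z = 0 → z ≠ zs → F zs < F z)
    {N : Set Z} (hN : IsOpen N) (hzN : zs ∈ N) :
    ∃ (M : ℝ) (Φ : Y × ℝ → Z × Y), 0 < M ∧ ∀ᶠ p in 𝓝 (0 : Y × ℝ),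
      ContDiffAt ℝ 1 Φ p ∧ ‖Φ p - (zs, νs)‖ ≤ M * ‖p.1‖ ∧
      (0 < p.2 → ∀ z ∈ C, (∀ z' ∈ N, scaledAug F H νs p z ≤ scaledAug F H νs p z') →
        Φ p = (z, νs + p.2⁻¹ • (p.1 - H z))) := by
  obtain ⟨Φ, hΦ, hΦ0, hsol, huniq⟩ := exists_implicit_kkt hF hH hfeas hstat hsosc hlicq
  have hΦc : ContinuousAt Φ 0 := hΦ.continuousAt
  obtain ⟨L, T, hT, hLip⟩ := hΦ.exists_lipschitzOnWith
  have hpc : ∀ᶠ p in 𝓝 (0 : Y × ℝ), p ∈ T ∧ ((0, p.2) : Y × ℝ) ∈ T ∧ Φ (0, p.2) = (zs, νs) := by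
    have hten : Tendsto (fun p : Y × ℝ => ((0, p.2) : Y × ℝ)) (𝓝 0) (𝓝 0) := by
      have : Continuous (fun p : Y × ℝ => ((0, p.2) : Y × ℝ)) := by fun_prop
      exact this.tendsto' 0 0 rfl
    have hten' : Tendsto (fun p : Y × ℝ => (((0, p.2) : Y × ℝ), (zs, νs))) (𝓝 0)
        (𝓝 (0, (zs, νs))) :=
      hten.prodMk_nhds tendsto_const_nhds
    have hT' := hten hT
    filter_upwards [hT, hT', hten'.eventually huniq] with p h1 h2 h3
    exact ⟨h1, h2, h3 hstat (by simp [hfeas])⟩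
  obtain ⟨r, hr, hball⟩ := Metric.eventually_nhds_iff_ball.1 huniq
  obtain ⟨V, hVsub, hV, hzV⟩ := mem_nhds_iff.1 (Filter.inter_mem (hN.mem_nhds hzN)
    (Filter.inter_mem (Metric.ball_mem_nhds zs hr) (tendsto_multiplier hF hH hstat hlicq hr)))
  have hmem := eventually_mem_of_scaledAug_le hF.continuous hH.continuous hfeas hC hmin hΦc hΦ0
    hsol hV hzV
  have hΦN : ∀ᶠ p in 𝓝 (0 : Y × ℝ), (Φ p).1 ∈ N := by
    have : Tendsto (fun p => (Φ p).1) (𝓝 0) (𝓝 zs) := by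
      simpa [hΦ0, ContinuousAt] using hΦc.fst
    exact this (hN.mem_nhds hzN)
  refine ⟨L + 1, Φ, by positivity, ?_⟩
  filter_upwards [hΦ.eventually (by simp), hpc, hmem, hΦN, Metric.ball_mem_nhds (0 : Y × ℝ) hr]
    with p h1 ⟨h2, h3, h4⟩ h5 h6 h7
  refine ⟨h1, ?_, fun hpos z hz hzmin => ?_⟩
  · have := hLip.dist_le_mul p h2 _ h3
    rw [h4, dist_eq_norm, dist_eq_norm] at this
    refine this.trans ?_
    have e : ‖p - ((0, p.2) : Y × ℝ)‖ = ‖p.1‖ := by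
      simp [Prod.norm_def]
    rw [e]
    gcongr
    simp
  · obtain ⟨hzN', hzr, hzm⟩ := hVsub (h5 z hz hpos (hzmin _ h6))
    have hloc : IsLocalMin (scaledAug F H νs p) z :=
      Filter.eventually_of_mem (hN.mem_nhds hzN') hzmin
    have hst := stationary_scaledAug (hF.differentiable two_ne_zero)
      (hH.differentiable two_ne_zero) hloc
    have hν := hzm _ hst
    refine hball (p, (z, νs + p.2⁻¹ • (p.1 - H z))) ?_ hst ?_
    · simp only [Metric.mem_ball, Prod.dist_eq (α := Y × ℝ), Prod.dist_eq (α := Z), max_lt_iff]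
      refine ⟨h7, hzr, ?_⟩
      rwa [dist_eq_norm]
    · simp [smul_smul, hpos.ne']

end EqualityConstrained

namespace EJA

variable {E : Type*} [NormedAddCommGroup E] [InnerProductSpace ℝ E]
  [FiniteDimensional ℝ E] (J : EJA E)

theorem contDiff_mul_self {k : WithTop ℕ∞} : ContDiff ℝ k fun y => J.jmul y y :=
  (J.jmul.toContinuousBilinearMap.contDiff (n := k)).clm_apply contDiff_id

theorem hasFDerivAt_mul_self (y : E) :
    HasFDerivAt (fun y => J.jmul y y) ((2 : ℝ) • J.jmul.toContinuousBilinearMap y) y := by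
  have := (J.jmul.toContinuousBilinearMap.hasFDerivAt (x := y)).clm_apply (hasFDerivAt_id y)
  refine this.congr_fderiv (ContinuousLinearMap.ext fun w => ?_)
  simp [two_smul, J.comm w y]

variable {n m : ℕ} (f : EuclideanSpace ℝ (Fin n) → ℝ)
  (h : EuclideanSpace ℝ (Fin n) → EuclideanSpace ℝ (Fin m))
  (g : EuclideanSpace ℝ (Fin n) → E)

/-- The equality constraint `(h x, g x - y ∘ y)` of the slack variable problem. -/
def slackMap (z : EuclideanSpace ℝ (Fin n) × E) : WithLp 2 (EuclideanSpace ℝ (Fin m) × E) :=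
  WithLp.toLp 2 (h z.1, g z.1 - J.jmul z.2 z.2)

variable {f h g}

theorem contDiff_slackMap (hh : ContDiff ℝ 2 h) (hg : ContDiff ℝ 2 g) :
    ContDiff ℝ 2 (J.slackMap h g) := by
  refine (WithLp.prodContinuousLinearEquiv 2 ℝ (EuclideanSpace ℝ (Fin m)) E).symm.contDiff.comp
    ((hh.comp contDiff_fst).prodMk ((hg.comp contDiff_fst).sub ?_))
  exact J.contDiff_mul_self.comp contDiff_snd

theorem fderiv_slackMap (hh : ContDiff ℝ 2 h) (hg : ContDiff ℝ 2 g)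
    (z : EuclideanSpace ℝ (Fin n) × E) (v : EuclideanSpace ℝ (Fin n)) (w : E) :
    fderiv ℝ (J.slackMap h g) z (v, w) =
      WithLp.toLp 2 (fderiv ℝ h z.1 v, fderiv ℝ g z.1 v - (2 : ℝ) • J.jmul z.2 w) := by
  have h1 := ((hh.differentiable two_ne_zero) z.1).hasFDerivAt.comp z hasFDerivAt_fst
  have h2 := ((hg.differentiable two_ne_zero) z.1).hasFDerivAt.comp z hasFDerivAt_fst
  have h3 := (J.hasFDerivAt_mul_self z.2).comp z hasFDerivAt_snd
  have h4 := (WithLp.prodContinuousLinearEquiv 2 ℝ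
    (EuclideanSpace ℝ (Fin m)) E).symm.hasFDerivAt.comp z (h1.prodMk (h2.sub h3))
  have h5 : fderiv ℝ (J.slackMap h g) z = _ := h4.fderiv
  rw [h5]
  simp

theorem inner_toLp_slackMap (μ : EuclideanSpace ℝ (Fin m)) (lam : E)
    (z : EuclideanSpace ℝ (Fin n) × E) :
    ⟪WithLp.toLp 2 (μ, lam), J.slackMap h g z⟫ =
      ⟪μ, h z.1⟫ + ⟪lam, g z.1 - J.jmul z.2 z.2⟫ := by
  rw [WithLp.prod_inner_apply]
  rfl

/-- The second derivative of the Lagrangian of the slack variable problem. -/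
theorem fderiv_fderiv_slackLagr (hf : ContDiff ℝ 2 f) (hh : ContDiff ℝ 2 h) (hg : ContDiff ℝ 2 g)
    (μ : EuclideanSpace ℝ (Fin m)) (lam : E) (z : EuclideanSpace ℝ (Fin n) × E)
    (v : EuclideanSpace ℝ (Fin n)) (w : E) :
    fderiv ℝ (fderiv ℝ (fun z : EuclideanSpace ℝ (Fin n) × E =>
      f z.1 - ⟪WithLp.toLp 2 (μ, lam), J.slackMap h g z⟫)) z (v, w) (v, w) =
      iteratedFDeriv ℝ 2 (lagr f h g μ lam) z.1 ![v, v] + 2 * ⟪J.jmul w w, lam⟫ := by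
  have hl : ContDiff ℝ 2 (lagr f h g μ lam) :=
    (hf.sub (hh.inner ℝ contDiff_const)).sub (hg.inner ℝ contDiff_const)
  have heq : (fun z : EuclideanSpace ℝ (Fin n) × E =>
      f z.1 - ⟪WithLp.toLp 2 (μ, lam), J.slackMap h g z⟫) =
      fun z => lagr f h g μ lam z.1 + ⟪lam, J.jmul z.2 z.2⟫ := by
    funext z
    rw [inner_toLp_slackMap, lagr, inner_sub_right, real_inner_comm μ, real_inner_comm lam (g z.1)]
    ring
  rw [heq]
  set l := lagr f h g μ lam
  set L : EuclideanSpace ℝ (Fin n) × E → ℝ := fun z => l z.1 + ⟪lam, J.jmul z.2 z.2⟫ with hLdef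
  have hL : ContDiff ℝ 2 L :=
    (hl.comp contDiff_fst).add (contDiff_const.inner ℝ (J.contDiff_mul_self.comp contDiff_snd))
  have h1 (z : EuclideanSpace ℝ (Fin n) × E) :
      fderiv ℝ L z (v, w) = fderiv ℝ l z.1 v + 2 * ⟪lam, J.jmul w z.2⟫ := by
    have a := ((hl.differentiable two_ne_zero) z.1).hasFDerivAt.comp z hasFDerivAt_fst
    have b := (J.hasFDerivAt_mul_self z.2).comp z hasFDerivAt_snd
    have c : fderiv ℝ L z = _ := (a.add ((hasFDerivAt_const lam z).inner ℝ b)).fderiv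
    rw [c]
    simp [inner_smul_right, J.comm w]
  have hDl : ContDiff ℝ 1 (fderiv ℝ l) := hl.fderiv_right (by norm_num)
  have hDL : ContDiff ℝ 1 (fderiv ℝ L) := hL.fderiv_right (by norm_num)
  have h2 : HasFDerivAt (fun z => fderiv ℝ L z (v, w)) _ z :=
    ((hDL.differentiable one_ne_zero) z).hasFDerivAt.clm_apply (hasFDerivAt_const (v, w) z)
  have h3 : HasFDerivAt (fun z : EuclideanSpace ℝ (Fin n) × E =>
      fderiv ℝ l z.1 v + 2 * ⟪lam, J.jmul w z.2⟫) _ z :=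
    ((((hDl.differentiable one_ne_zero) z.1).hasFDerivAt.comp z hasFDerivAt_fst).clm_apply
      (hasFDerivAt_const v z)).add
      (((hasFDerivAt_const lam z).inner ℝ
        ((J.jmul.toContinuousBilinearMap w).hasFDerivAt.comp z hasFDerivAt_snd)).const_mul 2)
  simp only [h1] at h2
  have h4 := congrArg (fun φ => φ (v, w)) (h2.unique h3)
  simp at h4
  rw [h4, iteratedFDeriv_two_apply, real_inner_comm]
  simp

end EJA

namespace EJA

variable {E : Type*} [NormedAddCommGroup E] [InnerProductSpace ℝ E]
  [FiniteDimensional ℝ E] (J : EJA E) {n m : ℕ} {f : EuclideanSpace ℝ (Fin n) → ℝ}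
  {h : EuclideanSpace ℝ (Fin n) → EuclideanSpace ℝ (Fin m)} {g : EuclideanSpace ℝ (Fin n) → E}

/-- A KKT triple of the conic problem is stationary for the slack variable problem. -/
theorem KKTP1.fderiv_eq (hf : ContDiff ℝ 2 f) (hh : ContDiff ℝ 2 h) (hg : ContDiff ℝ 2 g)
    {xs : EuclideanSpace ℝ (Fin n)} {μs : EuclideanSpace ℝ (Fin m)} {lams s : E}
    (hKKT : J.KKTP1 f h g xs μs lams) (hs : J.jmul s s = g xs)
    (d : EuclideanSpace ℝ (Fin n) × E) :
    fderiv ℝ (fun z : EuclideanSpace ℝ (Fin n) × E => f z.1) (xs, s) d =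
      ⟪WithLp.toLp 2 (μs, lams), fderiv ℝ (J.slackMap h g) (xs, s) d⟫ := by
  obtain ⟨hgrad, hlK, -, hcomp, -⟩ := hKKT
  have hzero : J.jmul lams s = 0 := by
    refine J.mul_eq_zero_of_inner_sq hlK ?_
    rw [hs, ← J.unit_jmul (g xs), J.comm, ← J.assoc_inner, hcomp, inner_zero_left]
  obtain ⟨v, w⟩ := d
  rw [J.fderiv_slackMap hh hg, WithLp.prod_inner_apply]
  have hdf := (hf.differentiable two_ne_zero) xs
  have h1 : fderiv ℝ (fun z : EuclideanSpace ℝ (Fin n) × E => f z.1) (xs, s) = _ :=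
    (HasFDerivAt.comp (f := Prod.fst) (g := f) (xs, s) hdf.hasFDerivAt hasFDerivAt_fst).fderiv
  have h2 : ⟪gradient f xs, v⟫ = fderiv ℝ f xs v := by simp [gradient]
  have h3 : gradient f xs = (fderiv ℝ h xs).adjoint μs + (fderiv ℝ g xs).adjoint lams := by
    rw [sub_sub, sub_eq_zero] at hgrad
    exact hgrad
  rw [h3, inner_add_left, ContinuousLinearMap.adjoint_inner_left,
    ContinuousLinearMap.adjoint_inner_left] at h2
  rw [h1]
  simp [inner_sub_right, inner_smul_right, ← J.assoc_inner, hzero, ← h2]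

/-- Nondegeneracy makes the derivative of the slack variable constraint surjective. -/
theorem eq_zero_of_inner_fderiv_slackMap (hh : ContDiff ℝ 2 h) (hg : ContDiff ℝ 2 g)
    {xs : EuclideanSpace ℝ (Fin n)} {s : E} (hsK : s ∈ J.K) (hs : J.jmul s s = g xs)
    (hnondeg : ∀ (v : EuclideanSpace ℝ (Fin m)) (w : E),
      (∀ u ∈ J.linTangent (g xs), ⟪w, u⟫ = 0) →
      (fderiv ℝ g xs).adjoint w + (fderiv ℝ h xs).adjoint v = 0 → w = 0 ∧ v = 0)
    (ν : WithLp 2 (EuclideanSpace ℝ (Fin m) × E))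
    (hν : ∀ d, ⟪ν, fderiv ℝ (J.slackMap h g) (xs, s) d⟫ = 0) : ν = 0 := by
  obtain ⟨v, w⟩ := ν
  have h1 (a : EuclideanSpace ℝ (Fin n)) (b : E) :
      ⟪v, fderiv ℝ h xs a⟫ + ⟪w, fderiv ℝ g xs a - (2 : ℝ) • J.jmul s b⟫ = 0 := by
    have := hν (a, b)
    rwa [J.fderiv_slackMap hh hg, WithLp.prod_inner_apply] at this
  have hsw : J.jmul s w = 0 := by
    have := h1 0 (J.jmul s w)
    rw [map_zero, map_zero, inner_zero_right, zero_sub, inner_neg_right, inner_smul_right,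
      ← J.assoc_inner, J.comm w s] at this
    rw [← inner_self_eq_zero (𝕜 := ℝ)]
    linarith
  obtain ⟨rfl, rfl⟩ := hnondeg v w
    (fun u hu => J.inner_linTangent_eq_zero hsK hsw (by rwa [hs])) (by
      refine ext_inner_right ℝ fun a => ?_
      rw [inner_add_left, ContinuousLinearMap.adjoint_inner_left,
        ContinuousLinearMap.adjoint_inner_left, inner_zero_left]
      have := h1 a 0
      rw [map_zero, smul_zero, sub_zero] at this
      linarith)
  rfl

/-- Square roots in the cone of `g x` are close to that of `g xs` for `x` close to `xs`. -/
theorem eventually_sqrt_mem (hg : Continuous g) {xs : EuclideanSpace ℝ (Fin n)} {s : E}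
    (hsK : s ∈ J.K) (hs : J.jmul s s = g xs) {W : Set (EuclideanSpace ℝ (Fin n) × E)}
    (hW : W ∈ 𝓝 (xs, s)) : ∀ᶠ x in 𝓝 xs, ∀ y ∈ J.K, J.jmul y y = g x → (x, y) ∈ W := by
  have hsq : Continuous fun y => J.jmul y y := (J.contDiff_mul_self (k := 0)).continuous
  set R : ℝ := (‖g xs‖ + 1) * ‖J.unit‖ + 1 with hR
  have hcpt : IsCompact (Metric.closedBall (0 : E) R ∩ J.K) :=
    (isCompact_closedBall _ _).inter_right J.isClosed_K
  have h1 : ∀ᶠ x in 𝓝 xs, ∀ y ∈ Metric.closedBall (0 : E) R ∩ J.K,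
      J.jmul y y = g x → (x, y) ∈ W := by
    refine hcpt.eventually_forall_of_forall_eventually
      (P := fun x y => J.jmul y y = g x → (x, y) ∈ W) fun y hy => ?_
    by_cases hyx : J.jmul y y = g xs
    · obtain rfl := J.eq_of_sq_eq hy.2 hsK (hyx.trans hs.symm)
      filter_upwards [hW] with q hq _
      exact hq
    · have : IsClosed {q : EuclideanSpace ℝ (Fin n) × E | J.jmul q.2 q.2 = g q.1} :=
        isClosed_eq (hsq.comp continuous_snd) (hg.comp continuous_fst)
      filter_upwards [this.isOpen_compl.mem_nhds hyx] with q hq h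
      exact absurd h hq
  have h2 : ∀ᶠ x in 𝓝 xs, ‖g x‖ < ‖g xs‖ + 1 :=
    hg.norm.continuousAt.eventually_lt_const (by linarith)
  filter_upwards [h1, h2] with x h3 h4 y hy hyx
  refine h3 y ⟨mem_closedBall_zero_iff.2 ?_, hy⟩ hyx
  have h5 := J.norm_sq_le_of_sq y
  rw [hyx] at h5
  have h6 : ‖g x‖ * ‖J.unit‖ ≤ (‖g xs‖ + 1) * ‖J.unit‖ := by gcongr
  have h7 : 0 ≤ (‖g xs‖ + 1) * ‖J.unit‖ := by positivity
  refine abs_le_of_sq_le_sq' ?_ (by positivity) |>.2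
  nlinarith

theorem norm_slackMap_sq (z : EuclideanSpace ℝ (Fin n) × E) :
    ‖J.slackMap h g z‖ ^ 2 = ‖h z.1‖ ^ 2 + ‖g z.1 - J.jmul z.2 z.2‖ ^ 2 := by
  rw [WithLp.prod_norm_sq_eq_of_L2]
  rfl

/-- The augmented Lagrangian of the slack variable problem in scaled form. -/
theorem scaledAug_slackMap {ρ : ℝ} (hρ : 0 < ρ) (μ μs : EuclideanSpace ℝ (Fin m)) (lam lams : E)
    (z : EuclideanSpace ℝ (Fin n) × E) :
    scaledAug (fun z => f z.1) (J.slackMap h g) (WithLp.toLp 2 (μs, lams))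
      (ρ⁻¹ • WithLp.toLp 2 (μ - μs, lam - lams), ρ⁻¹) z =
      J.augSlack f h g ρ μ lam z.1 z.2 + (2 * ρ)⁻¹ * ‖WithLp.toLp 2 (μ - μs, lam - lams)‖ ^ 2 := by
  have hd : WithLp.toLp 2 (μ - μs, lam - lams) =
      WithLp.toLp 2 (μ, lam) - WithLp.toLp 2 (μs, lams) := rfl
  have h1 : ⟪J.slackMap h g z, WithLp.toLp 2 (μ - μs, lam - lams)⟫ =
      ⟪WithLp.toLp 2 (μ, lam), J.slackMap h g z⟫ -
        ⟪WithLp.toLp 2 (μs, lams), J.slackMap h g z⟫ := by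
    rw [hd, real_inner_comm, inner_sub_left]
  have h2 := J.inner_toLp_slackMap (h := h) (g := g) μ lam z
  rw [scaledAug, augSlack, norm_sub_sq_real, inner_smul_right, h1, norm_smul, Real.norm_eq_abs,
    abs_of_pos (inv_pos.2 hρ), real_inner_comm μ, real_inner_comm lam]
  have h3 := J.norm_slackMap_sq (h := h) (g := g) z
  rw [mul_pow, h3, h2]
  field_simp
  ring

/-- Completing the square in the slack variable. -/
theorem augSlack_eq {ρ : ℝ} (hρ : 0 < ρ) (μ : EuclideanSpace ℝ (Fin m)) (lam : E)
    (x : EuclideanSpace ℝ (Fin n)) (y : E) :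
    J.augSlack f h g ρ μ lam x y = f x - ⟪h x, μ⟫ + ρ / 2 * ‖h x‖ ^ 2
      + 1 / (2 * ρ) * (-‖lam‖ ^ 2 + ‖lam - ρ • g x + ρ • J.jmul y y‖ ^ 2) := by
  have h1 : lam - ρ • g x + ρ • J.jmul y y = lam - ρ • (g x - J.jmul y y) := by
    rw [smul_sub]; abel
  rw [h1, norm_sub_sq_real, inner_smul_right, norm_smul, Real.norm_eq_abs, abs_of_pos hρ, augSlack,
    real_inner_comm lam]
  field_simp
  ring

theorem augSym_le_augSlack {P : E → E} (hP : ∀ v, J.IsProj v (P v)) {ρ : ℝ} (hρ : 0 < ρ)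
    (μ : EuclideanSpace ℝ (Fin m)) (lam : E) (x : EuclideanSpace ℝ (Fin n)) (y : E) :
    J.augSym f h g P ρ μ lam x ≤ J.augSlack f h g ρ μ lam x y := by
  rw [J.augSlack_eq hρ, augSym]
  set v := lam - ρ • g x
  obtain ⟨-, hin⟩ := IsProj.moreau J (hP v)
  have h1 : 0 ≤ ⟪P v, J.jmul y y⟫ := J.inner_nonneg_of_mem_K (hP v).1 ⟨y, rfl⟩
  have h2 : ‖P v‖ ^ 2 ≤ ⟪P v, v + ρ • J.jmul y y⟫ := by
    rw [inner_sub_right, real_inner_self_eq_norm_sq] at hin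
    rw [inner_add_right, inner_smul_right]
    nlinarith [mul_nonneg hρ.le h1]
  have h3 := real_inner_le_norm (P v) (v + ρ • J.jmul y y)
  have h4 : ‖P v‖ ^ 2 ≤ ‖v + ρ • J.jmul y y‖ ^ 2 := by
    nlinarith [sq_nonneg (‖P v‖ - ‖v + ρ • J.jmul y y‖)]
  gcongr

/-- The minimizing slack variable of the augmented Lagrangian. -/
theorem exists_slack {P : E → E} (hP : ∀ v, J.IsProj v (P v)) {ρ : ℝ} (hρ : 0 < ρ)
    (lam : E) (x : EuclideanSpace ℝ (Fin n)) :
    ∃ y ∈ J.K, lam - ρ • (g x - J.jmul y y) = P (lam - ρ • g x) ∧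
      ‖y‖ ^ 2 ≤ (‖g x‖ + ρ⁻¹ * ‖lam‖) * ‖J.unit‖ := by
  set v := lam - ρ • g x with hv
  obtain ⟨⟨y, hyK, hy⟩, hin⟩ := IsProj.moreau J (hP v)
  have hsq : ρ • J.jmul (Real.sqrt ρ⁻¹ • y) (Real.sqrt ρ⁻¹ • y) = P v - v := by
    rw [map_smul, map_smul, LinearMap.smul_apply, smul_smul, smul_smul, hy,
      mul_assoc, Real.mul_self_sqrt (by positivity), mul_inv_cancel₀ hρ.ne', one_smul]
  refine ⟨Real.sqrt ρ⁻¹ • y, J.smul_mem_K (Real.sqrt_nonneg _) hyK, ?_, ?_⟩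
  · rw [smul_sub, hsq, hv]
    abel
  · have h1 : ‖P v - v‖ ≤ ‖v‖ := by
      have h2 : ‖P v - v‖ ^ 2 = - ⟪v, P v - v⟫ := by
        rw [← real_inner_self_eq_norm_sq, inner_sub_left, hin, zero_sub]
      have h3 := neg_le_of_abs_le (abs_real_inner_le_norm v (P v - v))
      nlinarith [norm_nonneg v, norm_nonneg (P v - v)]
    have h4 : ‖v‖ ≤ ‖lam‖ + ρ * ‖g x‖ := by
      refine (norm_sub_le _ _).trans ?_
      rw [norm_smul, Real.norm_eq_abs, abs_of_pos hρ]
    rw [← hsq, norm_smul, Real.norm_eq_abs, abs_of_pos hρ] at h1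
    refine (J.norm_sq_le_of_sq _).trans ?_
    gcongr
    rw [← mul_le_mul_iff_right₀ hρ, mul_add, mul_inv_cancel_left₀ hρ.ne']
    linarith

theorem augSlack_eq_augSym {P : E → E} {ρ : ℝ} (hρ : 0 < ρ)
    (μ : EuclideanSpace ℝ (Fin m)) {lam : E} {x : EuclideanSpace ℝ (Fin n)} {y : E}
    (hy : lam - ρ • (g x - J.jmul y y) = P (lam - ρ • g x)) :
    J.augSlack f h g ρ μ lam x y = J.augSym f h g P ρ μ lam x := by
  rw [J.augSlack_eq hρ, augSym, ← hy, smul_sub, sub_sub_eq_add_sub, add_sub_right_comm]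

end EJA

theorem add_smul_inv_smul_sub {V : Type*} [AddCommGroup V] [Module ℝ V] {ρ : ℝ} (hρ : ρ ≠ 0)
    (a c b : V) : c + ρ⁻¹⁻¹ • (ρ⁻¹ • (a - c) - b) = a - ρ • b := by
  rw [inv_inv, smul_sub, smul_inv_smul₀ hρ]
  abel

/-- local convergence of the augmented Lagrangian method for
(P1): under SOSC-NSCP and nondegeneracy at a KKT triple `(x*, μ*, λ*)`, for
all `(μ, λ, ρ)` close to `(μ*, λ*)` (relative to `ρ`) with `ρ` large, the
local augmented-Lagrangian subproblem has a unique solution `x(μ, λ, ρ)`,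
depending continuously differentiably on `(μ, λ, ρ)`, with the standard
`M/ρ` error estimates for the solution and the updated multipliers. -/
theorem stmt19 {E : Type*} [NormedAddCommGroup E] [InnerProductSpace ℝ E]
    [FiniteDimensional ℝ E] (J : EJA E) {n m : ℕ}
    (f : EuclideanSpace ℝ (Fin n) → ℝ)
    (h : EuclideanSpace ℝ (Fin n) → EuclideanSpace ℝ (Fin m))
    (g : EuclideanSpace ℝ (Fin n) → E)
    (hf : ContDiff ℝ 2 f) (hh : ContDiff ℝ 2 h) (hg : ContDiff ℝ 2 g)
    (P : E → E) (hP : ∀ v : E, J.IsProj v (P v))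
    (xs : EuclideanSpace ℝ (Fin n)) (μs : EuclideanSpace ℝ (Fin m)) (lams : E)
    (hKKT : J.KKTP1 f h g xs μs lams)
    (s : E) (hsK : s ∈ J.K) (hs : J.jmul s s = g xs)
    (hsosc : ∀ (v : EuclideanSpace ℝ (Fin n)) (w : E), (v, w) ≠ (0, 0) →
      fderiv ℝ g xs v - (2 : ℝ) • J.jmul s w = 0 → fderiv ℝ h xs v = 0 →
      0 < iteratedFDeriv ℝ 2 (EJA.lagr f h g μs lams) xs ![v, v]
          + 2 * ⟪J.jmul w w, lams⟫)
    (hnondeg : ∀ (v : EuclideanSpace ℝ (Fin m)) (w : E),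
      (∀ u ∈ J.linTangent (g xs), ⟪w, u⟫ = 0) →
      (fderiv ℝ g xs).adjoint w + (fderiv ℝ h xs).adjoint v = 0 →
      w = 0 ∧ v = 0) :
    ∃ δ ε M ρbar : ℝ, 0 < δ ∧ 0 < ε ∧ 0 < M ∧ 0 < ρbar ∧
      ∃ xsol : EuclideanSpace ℝ (Fin m) × E × ℝ → EuclideanSpace ℝ (Fin n),
        (∀ (μ : EuclideanSpace ℝ (Fin m)) (lam : E) (ρ : ℝ),
          ‖μ - μs‖ + ‖lam - lams‖ < δ * ρ → ρbar ≤ ρ →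
          xsol (μ, lam, ρ) ∈ Metric.closedBall xs ε ∧
          (∀ x' ∈ Metric.closedBall xs ε,
            J.augSym f h g P ρ μ lam (xsol (μ, lam, ρ)) ≤
              J.augSym f h g P ρ μ lam x') ∧
          (∀ x' ∈ Metric.closedBall xs ε,
            (∀ x'' ∈ Metric.closedBall xs ε,
              J.augSym f h g P ρ μ lam x' ≤ J.augSym f h g P ρ μ lam x'') →
            x' = xsol (μ, lam, ρ)) ∧
          ‖xsol (μ, lam, ρ) - xs‖ ≤ M / ρ * (‖μ - μs‖ + ‖lam - lams‖) ∧
          ‖(μ - ρ • h (xsol (μ, lam, ρ))) - μs‖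
              + ‖P (lam - ρ • g (xsol (μ, lam, ρ))) - lams‖ ≤
            M / ρ * (‖μ - μs‖ + ‖lam - lams‖)) ∧
        ContDiffOn ℝ 1 xsol
          (interior {p : EuclideanSpace ℝ (Fin m) × E × ℝ |
            ‖p.1 - μs‖ + ‖p.2.1 - lams‖ < δ * p.2.2 ∧ ρbar ≤ p.2.2}) := by
  have hF : ContDiff ℝ 2 fun z : EuclideanSpace ℝ (Fin n) × E => f z.1 := hf.comp contDiff_fst
  have hH := J.contDiff_slackMap hh hg
  have hfeas : J.slackMap h g (xs, s) = 0 := by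
    simp [EJA.slackMap, hs, hKKT.2.2.2.2]
  have hstat := EJA.KKTP1.fderiv_eq J hf hh hg hKKT hs
  have hsosc' : ∀ d : EuclideanSpace ℝ (Fin n) × E, d ≠ 0 →
      fderiv ℝ (J.slackMap h g) (xs, s) d = 0 →
      0 < fderiv ℝ (fderiv ℝ (fun z : EuclideanSpace ℝ (Fin n) × E =>
        f z.1 - ⟪WithLp.toLp 2 (μs, lams), J.slackMap h g z⟫)) (xs, s) d d := by
    rintro ⟨v, w⟩ hd h0
    rw [J.fderiv_slackMap hh hg] at h0
    rw [J.fderiv_fderiv_slackLagr hf hh hg]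
    exact hsosc v w hd (congrArg (fun y => y.snd) h0) (congrArg (fun y => y.fst) h0)
  have hlicq := J.eq_zero_of_inner_fderiv_slackMap hh hg hsK hs hnondeg
  obtain ⟨ε, hε, hεmin⟩ := Metric.nhds_basis_closedBall.eventually_iff.1
    (J.eventually_sqrt_mem hg.continuous hsK hs
      (strict_local_min_of_sosc hF hH hfeas hstat hsosc'))
  obtain ⟨G, hG⟩ := (isCompact_closedBall xs ε).exists_bound_of_continuousOn
    hg.continuous.continuousOn
  set R : ℝ := (G + ‖lams‖ + 1) * ‖J.unit‖ + 1 with hR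
  have hG0 : 0 ≤ G := (norm_nonneg _).trans (hG xs (Metric.mem_closedBall_self hε.le))
  set C : Set (EuclideanSpace ℝ (Fin n) × E) :=
    Metric.closedBall xs ε ×ˢ (Metric.closedBall (0 : E) R ∩ J.K) with hCdef
  have hC : IsCompact C :=
    (isCompact_closedBall _ _).prod ((isCompact_closedBall _ _).inter_right J.isClosed_K)
  have hmin : ∀ z ∈ C, J.slackMap h g z = 0 → z ≠ (xs, s) → f xs < f z.1 := fun z hz h0 hne =>
    hεmin hz.1 z.2 hz.2.2 (sub_eq_zero.1 (congrArg (fun y => y.snd) h0)).symm h0 hne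
  obtain ⟨M, Φ, hM, hev⟩ := eventually_scaledAug_minimizer hF hH hfeas hstat hsosc' hlicq hC hmin
    (Metric.isOpen_ball.prod isOpen_univ : IsOpen (Metric.ball xs ε ×ˢ (Set.univ : Set E)))
    ⟨Metric.mem_ball_self hε, Set.mem_univ _⟩
  obtain ⟨r, hr, hball⟩ := Metric.eventually_nhds_iff_ball.1 hev
  let par : EuclideanSpace ℝ (Fin m) × E × ℝ → WithLp 2 (EuclideanSpace ℝ (Fin m) × E) × ℝ :=
    fun q => (q.2.2⁻¹ • WithLp.toLp 2 (q.1 - μs, q.2.1 - lams), q.2.2⁻¹)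
  have hnorm (μ : EuclideanSpace ℝ (Fin m)) (lam : E) {ρ : ℝ} (hρ : 0 < ρ) :
      ‖(par (μ, lam, ρ)).1‖ ≤ ρ⁻¹ * (‖μ - μs‖ + ‖lam - lams‖) := by
    simp only [par]
    rw [norm_smul, Real.norm_eq_abs, abs_of_pos (inv_pos.2 hρ)]
    gcongr
    refine abs_le_of_sq_le_sq' ?_ (by positivity) |>.2
    rw [WithLp.prod_norm_sq_eq_of_L2]
    change ‖μ - μs‖ ^ 2 + ‖lam - lams‖ ^ 2 ≤ _
    nlinarith [mul_nonneg (norm_nonneg (μ - μs)) (norm_nonneg (lam - lams))]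
  have hpar {μ : EuclideanSpace ℝ (Fin m)} {lam : E} {ρ : ℝ}
      (h1 : ‖μ - μs‖ + ‖lam - lams‖ < min 1 r * ρ) (h2 : 1 + r⁻¹ ≤ ρ) :
      1 ≤ ρ ∧ ρ⁻¹ * (‖μ - μs‖ + ‖lam - lams‖) < 1 ∧ par (μ, lam, ρ) ∈ Metric.ball 0 r := by
    have hr' := inv_pos.2 hr
    have hρ : 0 < ρ := by linarith
    have h3 : ρ⁻¹ * (‖μ - μs‖ + ‖lam - lams‖) < min 1 r := by
      rwa [inv_mul_lt_iff₀ hρ, mul_comm]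
    refine ⟨by linarith, h3.trans_le (min_le_left _ _), ?_⟩
    rw [mem_ball_zero_iff, Prod.norm_def, max_lt_iff]
    refine ⟨(hnorm μ lam hρ).trans_lt (h3.trans_le (min_le_right _ _)), ?_⟩
    simp only [par]
    rw [Real.norm_eq_abs, abs_of_pos (inv_pos.2 hρ)]
    exact inv_lt_of_inv_lt₀ hr (by linarith)
  refine ⟨min 1 r, ε, 2 * M, 1 + r⁻¹, by positivity, hε, by positivity, by positivity,
    fun q => (Φ (par q)).1.1, ?_, ?_⟩
  · intro μ lam ρ h1 h2
    obtain ⟨hρ1, hlt, hmem⟩ := hpar h1 h2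
    have hρ : 0 < ρ := by linarith
    obtain ⟨-, hest, hΦ⟩ := hball _ hmem
    have hslack : ∀ x ∈ Metric.closedBall xs ε, ∃ y, (x, y) ∈ C ∧
        lam - ρ • (g x - J.jmul y y) = P (lam - ρ • g x) := by
      intro x hx
      obtain ⟨y, hyK, hy, hyn⟩ := J.exists_slack (g := g) hP hρ lam x
      refine ⟨y, ⟨hx, mem_closedBall_zero_iff.2 ?_, hyK⟩, hy⟩
      have h3 : ρ⁻¹ * ‖lam‖ ≤ ‖lams‖ + 1 := by
        have h4 : ‖lam‖ ≤ ‖lams‖ + ‖lam - lams‖ := by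
          simpa using norm_add_le lams (lam - lams)
        rw [inv_mul_lt_iff₀ hρ] at hlt
        rw [inv_mul_le_iff₀ hρ]
        nlinarith [norm_nonneg (μ - μs), norm_nonneg lams]
      have h5 : (‖g x‖ + ρ⁻¹ * ‖lam‖) * ‖J.unit‖ ≤ (G + ‖lams‖ + 1) * ‖J.unit‖ := by
        refine mul_le_mul_of_nonneg_right ?_ (norm_nonneg _)
        linarith [hG x hx]
      have h6 : 0 ≤ (G + ‖lams‖ + 1) * ‖J.unit‖ := by positivity
      refine abs_le_of_sq_le_sq' ?_ (by positivity) |>.2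
      nlinarith
    have hkey : ∀ x ∈ Metric.closedBall xs ε, (∀ x' ∈ Metric.closedBall xs ε,
        J.augSym f h g P ρ μ lam x ≤ J.augSym f h g P ρ μ lam x') →
        ∃ y, Φ (par (μ, lam, ρ)) =
          ((x, y), WithLp.toLp 2 (μ - ρ • h x, P (lam - ρ • g x))) := by
      intro x hx hxmin
      obtain ⟨y, hyC, hy⟩ := hslack x hx
      refine ⟨y, ?_⟩
      rw [hΦ (inv_pos.2 hρ) (x, y) hyC]
      · congr 1
        rw [← hy]
        exact congrArg (WithLp.toLp 2) (Prod.ext (add_smul_inv_smul_sub hρ.ne' μ μs _)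
          (add_smul_inv_smul_sub hρ.ne' lam lams _))
      · intro z' hz'
        rw [J.scaledAug_slackMap hρ, J.scaledAug_slackMap hρ, J.augSlack_eq_augSym hρ μ hy]
        gcongr
        exact (hxmin z'.1 (Metric.ball_subset_closedBall hz'.1)).trans
          (J.augSym_le_augSlack hP hρ μ lam _ _)
    obtain ⟨x, hx, hxmin⟩ : ∃ x ∈ Metric.closedBall xs ε, ∀ x' ∈ Metric.closedBall xs ε,
        J.augSym f h g P ρ μ lam x ≤ J.augSym f h g P ρ μ lam x' := by
      have hcont : Continuous fun z : EuclideanSpace ℝ (Fin n) × E =>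
          J.augSlack f h g ρ μ lam z.1 z.2 := by
        have e1 := hf.continuous
        have e2 := hh.continuous
        have e3 := hg.continuous
        have e4 : Continuous fun z : EuclideanSpace ℝ (Fin n) × E => J.jmul z.2 z.2 :=
          (J.contDiff_mul_self (k := 0)).continuous.comp continuous_snd
        unfold EJA.augSlack
        fun_prop
      obtain ⟨y, hyC, -⟩ := hslack xs (Metric.mem_closedBall_self hε.le)
      obtain ⟨z, hzC, hz⟩ := hC.exists_isMinOn ⟨_, hyC⟩ hcont.continuousOn
      refine ⟨z.1, hzC.1, fun x' hx' => ?_⟩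
      obtain ⟨y', hyC', hy'⟩ := hslack x' hx'
      rw [← J.augSlack_eq_augSym hρ μ hy']
      exact (J.augSym_le_augSlack hP hρ μ lam _ _).trans (hz hyC')
    obtain ⟨y, hy⟩ := hkey x hx hxmin
    have hbound := hest.trans (mul_le_mul_of_nonneg_left (hnorm μ lam hρ) hM.le)
    rw [hy] at hbound
    have hS : 0 ≤ M * (ρ⁻¹ * (‖μ - μs‖ + ‖lam - lams‖)) := by positivity
    have hM2 : 2 * M / ρ * (‖μ - μs‖ + ‖lam - lams‖) =
        2 * (M * (ρ⁻¹ * (‖μ - μs‖ + ‖lam - lams‖))) := by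
      rw [div_eq_mul_inv]; ring
    simp only [hy, hM2]
    refine ⟨hx, hxmin, fun x' hx' hmin' => ?_, ?_, ?_⟩
    · obtain ⟨y', hy'⟩ := hkey x' hx' hmin'
      rw [hy] at hy'
      exact congrArg (fun q => q.1.1) hy'.symm
    · have := ((norm_fst_le _).trans (norm_fst_le _)).trans hbound
      exact this.trans (by linarith)
    · have h3 := (norm_snd_le _).trans hbound
      have h4 := (WithLp.norm_fst_le _ _).trans h3
      have h5 := (WithLp.norm_snd_le _ _).trans h3
      have h4' : ‖μ - ρ • h x - μs‖ ≤ _ := h4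
      have h5' : ‖P (lam - ρ • g x) - lams‖ ≤ _ := h5
      linarith
  · refine ContDiffOn.mono (fun q hq => ContDiffAt.contDiffWithinAt ?_) interior_subset
    obtain ⟨hρ1, -, hmem⟩ := hpar hq.1 hq.2
    have hpc : ContDiffAt ℝ 1 par q := by
      have hi : ContDiffAt ℝ 1 (fun q : EuclideanSpace ℝ (Fin m) × E × ℝ => q.2.2⁻¹) q :=
        (contDiff_snd.comp contDiff_snd).contDiffAt.inv (zero_lt_one.trans_le hρ1).ne'
      refine (hi.smul ?_).prodMk hi
      refine ContDiff.contDiffAt ((WithLp.prodContinuousLinearEquiv 2 ℝ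
        (EuclideanSpace ℝ (Fin m)) E).symm.contDiff.comp ?_)
      fun_prop
    exact ((hball _ hmem).1.comp q hpc).fst.fst
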